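/- Let ε>0 be a constant and let p = p(n) satisfy p < n^{-1/3-ε}. Let G ~ G_{n,p}. Then with high probability there is no tree T ⊆ G such that T activates G, i.e. no tree T ⊆ G with T → G in the K_3-bootstrap percolation process. -/

import Mathlib

namespace WSat

variable {V : Type} [Fintype V] [DecidableEq V]

/-- The number of (non-isolated) vertices of `G`. -/
noncomputable def supportCard (G : SimpleGraph V) : ℕ := Nat.card G.support

/-- The number of edges of `G`. -/
noncomputable def edgeCard (G : SimpleGraph V) : ℕ := Nat.card G.edgeSet

/-- One step of `K₃`-bootstrap percolation inside an ambient graph `G`: the graph `B` is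
obtained from `A` by adding a single edge of `G` that lies in a triangle of `B`. -/
def BootStep (G A B : SimpleGraph V) : Prop :=
  ∃ u v : V, G.Adj u v ∧ ¬ A.Adj u v ∧
    B = A ⊔ SimpleGraph.fromEdgeSet {s(u, v)} ∧ ∃ w : V, A.Adj u w ∧ A.Adj v w

/-- `H` activates `G'` in `G` (written `H → G'` in the paper). -/
def Activates (G H G' : SimpleGraph V) : Prop :=
  H ≤ G ∧ Relation.ReflTransGen (BootStep G) H G'

open scoped Classical in
/-- The probability that the binomial random graph `G_{n,p}` (on vertex set `Fin n`, each
of the `n.choose 2` possible edges present independently with probability `p`) belongs to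
the set `A`. -/
noncomputable def gnpProb (n : ℕ) (p : ℝ) (A : Set (SimpleGraph (Fin n))) : ℝ :=
  ∑ G : SimpleGraph (Fin n),
    if G ∈ A then p ^ edgeCard G * (1 - p) ^ (n.choose 2 - edgeCard G) else 0


set_option linter.unusedSectionVars false

/-! ### Chains modulo two -/

/-- The three edges of the (ordered) triangle `t`. -/
def tri (t : V × V × V) : Finset (Sym2 V) :=
  {s(t.1, t.2.1), s(t.1, t.2.2), s(t.2.1, t.2.2)}

/-- The activated edge of `t`. -/
def top (t : V × V × V) : Sym2 V := s(t.1, t.2.1)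

/-- Boundary mod two of a set of triangles. -/
def bd (S : Finset (V × V × V)) (e : Sym2 V) : ZMod 2 :=
  ∑ t ∈ S, if e ∈ tri t then 1 else 0

/-- The mod-two edge chain of a walk. -/
def zw {H : SimpleGraph V} {a b : V} (w : H.Walk a b) (e : Sym2 V) : ZMod 2 :=
  (w.edges.count e : ZMod 2)

/-- The coboundary of a vertex function. -/
def cob (φ : V → ZMod 2) : Sym2 V → ZMod 2 :=
  Sym2.lift ⟨fun a b => φ a + φ b, fun _ _ => add_comm _ _⟩

/-- The mixed cochain used in the rectangle inequality. -/
def om (φ ψ : V → ZMod 2) : Sym2 V → ZMod 2 :=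
  Sym2.lift ⟨fun a b => (ψ a + ψ b) * (φ a * ψ a + φ b * ψ b), fun a b => by ring⟩

lemma z2_add_self (x : ZMod 2) : x + x = 0 := by
  revert x; decide

lemma bd_symmDiff (S T : Finset (V × V × V)) (e : Sym2 V) :
    bd (symmDiff S T) e = bd S e + bd T e := by
  unfold bd
  have h1 : ∑ t ∈ S, (if e ∈ tri t then (1 : ZMod 2) else 0)
      = ∑ t ∈ S \ T, (if e ∈ tri t then (1 : ZMod 2) else 0)
        + ∑ t ∈ S ∩ T, (if e ∈ tri t then (1 : ZMod 2) else 0) := by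
    rw [add_comm]; exact (Finset.sum_inter_add_sum_sdiff S T _).symm
  have h2 : ∑ t ∈ T, (if e ∈ tri t then (1 : ZMod 2) else 0)
      = ∑ t ∈ T \ S, (if e ∈ tri t then (1 : ZMod 2) else 0)
        + ∑ t ∈ S ∩ T, (if e ∈ tri t then (1 : ZMod 2) else 0) := by
    rw [add_comm, Finset.inter_comm]; exact (Finset.sum_inter_add_sum_sdiff T S _).symm
  have h3 : symmDiff S T = (S \ T) ∪ (T \ S) := rfl
  rw [h1, h2, h3, Finset.sum_union (by
    rw [Finset.disjoint_left]; intro a ha hb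
    simp only [Finset.mem_sdiff] at ha hb; exact ha.2 hb.1)]
  have := z2_add_self (∑ t ∈ S ∩ T, (if e ∈ tri t then (1 : ZMod 2) else 0))
  linear_combination -this

lemma card_symmDiff_le' (S T : Finset (V × V × V)) :
    (symmDiff S T).card ≤ S.card + T.card := by
  have h3 : symmDiff S T = (S \ T) ∪ (T \ S) := rfl
  rw [h3]
  refine (Finset.card_union_le _ _).trans ?_
  exact Nat.add_le_add (Finset.card_le_card Finset.sdiff_subset)
    (Finset.card_le_card Finset.sdiff_subset)

lemma symmDiff_sub {S T X : Finset (V × V × V)} (hS : S ⊆ X) (hT : T ⊆ X) :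
    symmDiff S T ⊆ X := by
  intro a ha
  rw [Finset.mem_symmDiff] at ha
  rcases ha with h | h
  · exact hS h.1
  · exact hT h.1

section walks
variable {H : SimpleGraph V}

lemma zw_append {a b c : V} (w : H.Walk a b) (w' : H.Walk b c) (e : Sym2 V) :
    zw (w.append w') e = zw w e + zw w' e := by
  simp [zw, SimpleGraph.Walk.edges_append]

lemma zw_reverse {a b : V} (w : H.Walk a b) (e : Sym2 V) :
    zw w.reverse e = zw w e := by
  simp [zw, SimpleGraph.Walk.edges_reverse]

lemma zw_pair {a b : V} (w : H.Walk a b) (f : Sym2 V → ZMod 2) :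
    ∑ e, f e * zw w e = ∑ i ∈ Finset.range w.length, f s(w.getVert i, w.getVert (i + 1)) := by
  induction w with
  | nil => simp [zw]
  | cons h p ih =>
    rw [SimpleGraph.Walk.length_cons, Finset.sum_range_succ']
    simp only [SimpleGraph.Walk.getVert_cons_succ, SimpleGraph.Walk.getVert_zero, zero_add]
    rw [← ih]
    simp only [zw, SimpleGraph.Walk.edges_cons, List.count_cons, Nat.cast_add, mul_add,
      Finset.sum_add_distrib]
    congr 1
    simp

lemma bd_pair (S : Finset (V × V × V)) (f : Sym2 V → ZMod 2) :
    ∑ e, f e * bd S e = ∑ t ∈ S, ∑ e ∈ tri t, f e := by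
  unfold bd
  simp only [Finset.mul_sum]
  rw [Finset.sum_comm]
  refine Finset.sum_congr rfl fun t _ => ?_
  simp [Finset.sum_ite_mem]

lemma cob_sum {a b : V} (w : H.Walk a b) (φ : V → ZMod 2) (i j : ℕ) (hij : i ≤ j) :
    ∑ k ∈ Finset.Ico i j, cob φ s(w.getVert k, w.getVert (k + 1))
      = φ (w.getVert i) + φ (w.getVert j) := by
  induction j, hij using Nat.le_induction with
  | base => simp [z2_add_self]
  | succ j hij ih =>
    rw [Finset.sum_Ico_succ_top hij, ih]
    have := z2_add_self (φ (w.getVert j))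
    simp only [cob, Sym2.lift_mk]
    linear_combination this

/-- splitting a walk at an index -/
lemma split_at {a b : V} (w : H.Walk a b) (i : ℕ) (hi : i ≤ w.length) :
    ∃ (A : H.Walk a (w.getVert i)) (B : H.Walk (w.getVert i) b),
      A.length = i ∧ B.length = w.length - i ∧ w = A.append B ∧
        ∀ k, B.getVert k = w.getVert (i + k) := by
  refine ⟨w.take i, w.drop i, ?_, ?_, ?_, ?_⟩
  · simp [hi]
  · simp
  · simp
  · intro k; simp

lemma split_walk {a : V} (w : H.Walk a a) (i j : ℕ) (hij : i ≤ j) (hj : j ≤ w.length)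
    (P : H.Walk (w.getVert i) (w.getVert j)) :
    ∃ (x : V) (w1 : H.Walk x x) (w2 : H.Walk a a),
      w1.length = (j - i) + P.length ∧ w2.length = w.length - (j - i) + P.length ∧
      ∀ e, zw w e = zw w1 e + zw w2 e := by
  obtain ⟨A, B, hA, hB, hw, hv⟩ := split_at w i (hij.trans hj)
  obtain ⟨B1, B2, h1, h2, h3, -⟩ := split_at B (j - i) (by omega)
  have hx : B.getVert (j - i) = w.getVert j := by rw [hv]; congr 1; omega
  refine ⟨w.getVert i, B1.append ((P.copy rfl hx.symm).reverse),
    A.append ((P.copy rfl hx.symm).append B2), ?_, ?_, ?_⟩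
  · simp [h1]
  · simp [hA, h2, hB]; omega
  · intro e
    have hc : zw (P.copy rfl hx.symm) e = zw P e := by simp [zw]
    have h0 : zw w e = zw A e + (zw B1 e + zw B2 e) := by
      rw [← zw_append, ← h3, ← zw_append, ← hw]
    rw [h0]
    simp only [zw_append, zw_reverse, hc]
    linear_combination - z2_add_self (zw P e)

end walks

/-! ### The rectangle inequality and chords -/

/-- the triangle `t` lies in `H` -/
def InG (H : SimpleGraph V) (t : V × V × V) : Prop :=
  H.Adj t.1 t.2.1 ∧ H.Adj t.1 t.2.2 ∧ H.Adj t.2.1 t.2.2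

lemma tri_sum {H : SimpleGraph V} {t : V × V × V} (ht : InG H t) {A : Type*} [AddCommMonoid A]
    (f : Sym2 V → A) :
    ∑ e ∈ tri t, f e = f s(t.1, t.2.1) + f s(t.1, t.2.2) + f s(t.2.1, t.2.2) := by
  obtain ⟨h1, h2, h3⟩ := ht
  have n1 := h1.ne
  have n2 := h2.ne
  have n3 := h3.ne
  unfold tri
  rw [Finset.sum_insert, Finset.sum_insert, Finset.sum_singleton, add_assoc]
  · simp only [Finset.mem_singleton, Sym2.eq_iff]
    tauto
  · simp only [Finset.mem_insert, Finset.mem_singleton, Sym2.eq_iff]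
    tauto

lemma tri_card {H : SimpleGraph V} {t : V × V × V} (ht : InG H t) : (tri t).card = 3 := by
  rw [Finset.card_eq_sum_ones, tri_sum ht]

/-- vertices within distance `r` of the stretch `[lo, hi]` of the walk -/
def near {H : SimpleGraph V} {a b : V} (w : H.Walk a b) (lo hi r : ℕ) (v : V) : Prop :=
  ∃ i, lo ≤ i ∧ i ≤ hi ∧ ∃ P : H.Walk (w.getVert i) v, P.length ≤ r

lemma near_step {H : SimpleGraph V} {a b : V} {w : H.Walk a b} {lo hi r : ℕ} {u v : V}
    (h : near w lo hi r u) (huv : u = v ∨ H.Adj u v) {r' : ℕ} (hr : r < r') :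
    near w lo hi r' v := by
  obtain ⟨i, h1, h2, P, hP⟩ := h
  rcases huv with rfl | huv
  · exact ⟨i, h1, h2, P, by omega⟩
  · refine ⟨i, h1, h2, P.append (SimpleGraph.Walk.cons huv SimpleGraph.Walk.nil), ?_⟩
    simp
    omega

/-- vertex of a triangle -/
def IsV (t : V × V × V) (v : V) : Prop := v = t.1 ∨ v = t.2.1 ∨ v = t.2.2

lemma isV_adj {H : SimpleGraph V} {t : V × V × V} (ht : InG H t) {u v : V}
    (hu : IsV t u) (hv : IsV t v) : u = v ∨ H.Adj u v := by
  obtain ⟨h1, h2, h3⟩ := ht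
  rcases hu with rfl | rfl | rfl <;> rcases hv with rfl | rfl | rfl <;>
    simp [h1, h2, h3, h1.symm, h2.symm, h3.symm]

lemma om_cross (φ ψ : V → ZMod 2) {H : SimpleGraph V} {t : V × V × V} (ht : InG H t)
    (h : ∑ e ∈ tri t, om φ ψ e ≠ 0) :
    (∃ u v, IsV t u ∧ IsV t v ∧ φ u ≠ φ v) ∧ (∃ u v, IsV t u ∧ IsV t v ∧ ψ u ≠ ψ v) := by
  rw [tri_sum ht] at h
  simp only [om, Sym2.lift_mk] at h
  have key : ∀ a b c x y z : ZMod 2, ((a = b ∧ a = c) ∨ (x = y ∧ x = z)) →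
      (x + y) * (a * x + b * y) + (x + z) * (a * x + c * z) + (y + z) * (b * y + c * z) = 0 := by
    decide
  constructor
  · by_contra hc
    push Not at hc
    exact h (key _ _ _ _ _ _ (Or.inl ⟨hc _ _ (Or.inl rfl) (Or.inr (Or.inl rfl)),
      hc _ _ (Or.inl rfl) (Or.inr (Or.inr rfl))⟩))
  · by_contra hc
    push Not at hc
    exact h (key _ _ _ _ _ _ (Or.inr ⟨hc _ _ (Or.inl rfl) (Or.inr (Or.inl rfl)),
      hc _ _ (Or.inl rfl) (Or.inr (Or.inr rfl))⟩))

/-- the triangle crosses the level set -/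
def Cross (t : V × V × V) (φ : V → Prop) : Prop :=
  ∃ u v, IsV t u ∧ IsV t v ∧ φ u ∧ ¬ φ v

lemma cross_level {H : SimpleGraph V} {a b : V} {w : H.Walk a b} {lo hi r r' : ℕ}
    {t : V × V × V} (ht : InG H t)
    (h : Cross t (near w lo hi r)) (h' : Cross t (near w lo hi r')) : r = r' := by
  rcases lt_trichotomy r r' with hlt | heq | hlt
  · obtain ⟨u, _, hu, _, hu', _⟩ := h
    obtain ⟨_, v, _, hv, _, hv'⟩ := h'
    exact absurd (near_step hu' (isV_adj ht hu hv) hlt) hv'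
  · exact heq
  · obtain ⟨u, _, hu, _, hu', _⟩ := h'
    obtain ⟨_, v, _, hv, _, hv'⟩ := h
    exact absurd (near_step hu' (isV_adj ht hu hv) hlt) hv'

open scoped Classical in
lemma exists_cross {H : SimpleGraph V} {a : V} (w : H.Walk a a) (S : Finset (V × V × V))
    (hS : ∀ t ∈ S, InG H t) (hbd : ∀ e, bd S e = zw w e) (R M : ℕ)
    (hnc : ∀ i j, M + i ≤ j → j + M ≤ w.length + i → j ≤ w.length →
      ∀ P : H.Walk (w.getVert i) (w.getVert j), 2 * R < P.length)
    (s r k : ℕ) (hs : 2 * M ≤ s) (hs' : s + 2 * M ≤ w.length) (hr : r < R) (hk : k < R) :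
    ∃ t ∈ S, Cross t (near w s (s + M) r) ∧ Cross t (near w (s - M) s k) := by
  set φ : V → ZMod 2 := fun v => if near w s (s + M) r v then 1 else 0 with hφ
  set ψ : V → ZMod 2 := fun v => if near w (s - M) s k v then 1 else 0 with hψ
  have hφA : ∀ i, s ≤ i → i ≤ s + M → φ (w.getVert i) = 1 := by
    intro i h1 h2
    have : near w s (s + M) r (w.getVert i) := ⟨i, h1, h2, SimpleGraph.Walk.nil, by simp⟩
    simp [hφ, this]
  have hψB : ∀ i, s - M ≤ i → i ≤ s → ψ (w.getVert i) = 1 := by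
    intro i h1 h2
    have : near w (s - M) s k (w.getVert i) := ⟨i, h1, h2, SimpleGraph.Walk.nil, by simp⟩
    simp [hψ, this]
  have hφ0 : ∀ j, j ≤ s - M → φ (w.getVert j) = 0 := by
    intro j hj
    have : ¬ near w s (s + M) r (w.getVert j) := by
      rintro ⟨i, h1, h2, P, hP⟩
      have := hnc j i (by omega) (by omega) (by omega) P.reverse
      rw [SimpleGraph.Walk.length_reverse] at this
      omega
    simp [hφ, this]
  have hψ0 : ∀ j, s + M ≤ j → j ≤ w.length → ψ (w.getVert j) = 0 := by
    intro j hj hj'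
    have : ¬ near w (s - M) s k (w.getVert j) := by
      rintro ⟨i, h1, h2, P, hP⟩
      have := hnc i j (by omega) (by omega) (by omega) P
      omega
    simp [hψ, this]
  have hsum : ∑ t ∈ S, ∑ e ∈ tri t, om φ ψ e = 1 := by
    rw [← bd_pair]
    simp only [hbd]
    rw [zw_pair]
    rw [Finset.range_eq_Ico, ← Finset.sum_Ico_consecutive _ (Nat.zero_le (s - M)) (by omega),
      ← Finset.sum_Ico_consecutive _ (show s - M ≤ s by omega) (show s ≤ w.length by omega),
      ← Finset.sum_Ico_consecutive _ (show s ≤ s + M by omega)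
        (show s + M ≤ w.length by omega)]
    have e1 : ∑ i ∈ Finset.Ico 0 (s - M), om φ ψ s(w.getVert i, w.getVert (i + 1)) = 0 := by
      refine Finset.sum_eq_zero fun i hi => ?_
      rw [Finset.mem_Ico] at hi
      simp [om, hφ0 i (by omega), hφ0 (i + 1) (by omega)]
    have e2 : ∑ i ∈ Finset.Ico (s - M) s, om φ ψ s(w.getVert i, w.getVert (i + 1)) = 0 := by
      refine Finset.sum_eq_zero fun i hi => ?_
      rw [Finset.mem_Ico] at hi
      simp only [om, Sym2.lift_mk, hψB i (by omega) (by omega),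
        hψB (i + 1) (by omega) (by omega), z2_add_self, zero_mul]
    have e4 : ∑ i ∈ Finset.Ico (s + M) w.length,
        om φ ψ s(w.getVert i, w.getVert (i + 1)) = 0 := by
      refine Finset.sum_eq_zero fun i hi => ?_
      rw [Finset.mem_Ico] at hi
      simp [om, hψ0 i (by omega) (by omega), hψ0 (i + 1) (by omega) (by omega)]
    have e3 : ∑ i ∈ Finset.Ico s (s + M), om φ ψ s(w.getVert i, w.getVert (i + 1))
        = ∑ i ∈ Finset.Ico s (s + M), cob ψ s(w.getVert i, w.getVert (i + 1)) := by
      refine Finset.sum_congr rfl fun i hi => ?_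
      rw [Finset.mem_Ico] at hi
      simp only [om, cob, Sym2.lift_mk, hφA i (by omega) (by omega),
        hφA (i + 1) (by omega) (by omega), one_mul]
      generalize ψ (w.getVert i) = x
      generalize ψ (w.getVert (i + 1)) = y
      revert x y
      decide
    rw [e1, e2, e3, e4, cob_sum w ψ s (s + M) (by omega), hψB s (by omega) le_rfl,
      hψ0 (s + M) le_rfl (by omega)]
    simp
  have hex : ∃ t ∈ S, ∑ e ∈ tri t, om φ ψ e ≠ 0 := by
    by_contra hc
    push Not at hc
    rw [Finset.sum_eq_zero hc] at hsum
    exact absurd hsum (by decide)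
  obtain ⟨t, ht, hne⟩ := hex
  obtain ⟨⟨u, v, hu, hv, huv⟩, ⟨u', v', hu', hv', huv'⟩⟩ := om_cross φ ψ (hS t ht) hne
  refine ⟨t, ht, ?_, ?_⟩
  · by_cases h1 : near w s (s + M) r u
    · by_cases h2 : near w s (s + M) r v
      · exact absurd (by simp [hφ, h1, h2]) huv
      · exact ⟨u, v, hu, hv, h1, h2⟩
    · by_cases h2 : near w s (s + M) r v
      · exact ⟨v, u, hv, hu, h2, h1⟩
      · exact absurd (by simp [hφ, h1, h2]) huv
  · by_cases h1 : near w (s - M) s k u'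
    · by_cases h2 : near w (s - M) s k v'
      · exact absurd (by simp [hψ, h1, h2]) huv'
      · exact ⟨u', v', hu', hv', h1, h2⟩
    · by_cases h2 : near w (s - M) s k v'
      · exact ⟨v', u', hv', hu', h2, h1⟩
      · exact absurd (by simp [hψ, h1, h2]) huv'

lemma no_chord_area {H : SimpleGraph V} {a : V} (w : H.Walk a a) (S : Finset (V × V × V))
    (hS : ∀ t ∈ S, InG H t) (hbd : ∀ e, bd S e = zw w e) (R M : ℕ)
    (hnc : ∀ i j, M + i ≤ j → j + M ≤ w.length + i → j ≤ w.length →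
      ∀ P : H.Walk (w.getVert i) (w.getVert j), 2 * R < P.length) :
    (w.length - 4 * M) * (R * R) ≤ (2 * M) * S.card := by
  classical
  set D : Finset (ℕ × ℕ × ℕ) := Finset.Ico (2 * M) (w.length - 2 * M) ×ˢ
    (Finset.range R ×ˢ Finset.range R) with hD
  have hDc : D.card = (w.length - 4 * M) * (R * R) := by
    simp only [hD, Finset.card_product, Nat.card_Ico, Finset.card_range]
    congr 1
    omega
  have hex : ∀ d ∈ D, ∃ t ∈ S, Cross t (near w d.1 (d.1 + M) d.2.1) ∧
      Cross t (near w (d.1 - M) d.1 d.2.2) := by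
    rintro ⟨s, r, k⟩ hd
    simp only [hD, Finset.mem_product, Finset.mem_Ico, Finset.mem_range] at hd
    exact exists_cross w S hS hbd R M hnc s r k hd.1.1 (by omega) hd.2.1 hd.2.2
  haveI : Nonempty V := ⟨a⟩
  choose! F hFS hF1 hF2 using hex
  rw [← hDc]
  refine (Finset.card_le_mul_card_image_of_maps_to (f := F) (t := S) hFS (2 * M) ?_)
  intro t ht
  set E := D.filter (fun d => F d = t) with hE
  rcases E.eq_empty_or_nonempty with h0 | hne
  · rw [h0]; simp
  obtain ⟨d0, hd0, hmin⟩ := Finset.exists_min_image E (fun d => d.1) hne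
  have hsub : E.image (fun d => d.1) ⊆ Finset.Ico d0.1 (d0.1 + 2 * M) := by
    intro s hs
    rw [Finset.mem_image] at hs
    obtain ⟨d, hd, rfl⟩ := hs
    rw [Finset.mem_Ico]
    refine ⟨hmin d hd, ?_⟩
    have hdE := hd
    have hd0E := hd0
    rw [hE, Finset.mem_filter] at hd hd0
    have c1 := hF1 d hd.1
    have c0 := hF1 d0 hd0.1
    rw [hd.2] at c1
    rw [hd0.2] at c0
    obtain ⟨u, _, hu, _, ⟨i, i1, i2, P, hP⟩, _⟩ := c1
    obtain ⟨u0, _, hu0, _, ⟨j, j1, j2, Q, hQ⟩, _⟩ := c0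
    have hd1 := hd.1
    have hd01 := hd0.1
    simp only [hD, Finset.mem_product, Finset.mem_Ico, Finset.mem_range] at hd1 hd01
    by_contra hcon
    have hfar : M + j ≤ i := by omega
    have hQ' : ∃ Q' : H.Walk (w.getVert j) u, Q'.length ≤ d0.2.1 + 1 := by
      rcases isV_adj (hS t ht) hu0 hu with rfl | hadj
      · exact ⟨Q, by omega⟩
      · refine ⟨Q.append (SimpleGraph.Walk.cons hadj SimpleGraph.Walk.nil), ?_⟩
        simp
        omega
    obtain ⟨Q', hQ'⟩ := hQ'
    have := hnc j i hfar (by omega) (by omega) (Q'.append P.reverse)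
    rw [SimpleGraph.Walk.length_append, SimpleGraph.Walk.length_reverse] at this
    omega
  have hinj : Set.InjOn (fun d : ℕ × ℕ × ℕ => d.1) (E : Set (ℕ × ℕ × ℕ)) := by
    rintro ⟨s, r, k⟩ hd ⟨s', r', k'⟩ hd' hss
    simp only at hss
    subst hss
    rw [Finset.mem_coe, hE, Finset.mem_filter] at hd hd'
    have a1 := hF1 _ hd.1
    have a2 := hF2 _ hd.1
    have b1 := hF1 _ hd'.1
    have b2 := hF2 _ hd'.1
    rw [hd.2] at a1 a2
    rw [hd'.2] at b1 b2
    have e1 := cross_level (hS t ht) a1 b1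
    have e2 := cross_level (hS t ht) a2 b2
    simp only at e1 e2
    rw [e1, e2]
  calc E.card = (E.image (fun d => d.1)).card := (Finset.card_image_of_injOn hinj).symm
    _ ≤ (Finset.Ico d0.1 (d0.1 + 2 * M)).card := Finset.card_le_card hsub
    _ = 2 * M := by simp

/-! ### Built complexes and the local isoperimetric inequality -/

/-- edges of a set of triangles -/
def ES (S : Finset (V × V × V)) : Finset (Sym2 V) := S.biUnion tri

/-- vertices of a set of triangles -/
def VS (S : Finset (V × V × V)) : Finset V := S.biUnion fun t => {t.1, t.2.1, t.2.2}

/-- The properties of the set `X` of triangles used in an activation process ending with `H`. -/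
structure Built (H : SimpleGraph V) (X : Finset (V × V × V)) : Prop where
  inG : ∀ t ∈ X, InG H t
  r1 : ∀ S ⊆ X, S.Nonempty → ∃ e, bd S e ≠ 0
  r2 : ∀ S ⊆ X, ∀ g : V → ZMod 2, (∀ e ∈ ES S \ S.image top, cob g e = 0) →
    ∀ e ∈ ES S, cob g e = 0
  r3 : Set.InjOn top (X : Set (V × V × V))

lemma built_nil (T : SimpleGraph V) : Built T ∅ where
  inG := by simp
  r1 := by
    intro S hS hne
    rw [Finset.subset_empty.mp hS] at hne
    simp at hne
  r2 := by
    intro S hS g _ e he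
    rw [Finset.subset_empty.mp hS] at he
    simp [ES] at he
  r3 := by simp

lemma tri_edge {H : SimpleGraph V} {t : V × V × V} (ht : InG H t) {e : Sym2 V} (he : e ∈ tri t) :
    e ∈ H.edgeSet := by
  obtain ⟨h1, h2, h3⟩ := ht
  simp only [tri, Finset.mem_insert, Finset.mem_singleton] at he
  rcases he with rfl | rfl | rfl <;> simpa

lemma top_mem_tri (t : V × V × V) : top t ∈ tri t := by
  simp [top, tri]

lemma bd_eq_zero_of_notMem {S : Finset (V × V × V)} {e : Sym2 V} (he : e ∉ ES S) :
    bd S e = 0 := by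
  unfold bd
  refine Finset.sum_eq_zero fun t ht => ?_
  rw [if_neg]
  intro h
  exact he (Finset.mem_biUnion.mpr ⟨t, ht, h⟩)

lemma built_step {H : SimpleGraph V} {X : Finset (V × V × V)} (hB : Built H X) {u v w : V}
    (huv : u ≠ v) (hn : ¬ H.Adj u v) (hu : H.Adj u w) (hv : H.Adj v w) :
    Built (H ⊔ SimpleGraph.fromEdgeSet {s(u, v)}) (insert (u, v, w) X) := by
  have hnotin : ∀ S ⊆ X, s(u, v) ∉ ES S := by
    intro S hS h
    obtain ⟨t, ht, h⟩ := Finset.mem_biUnion.mp h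
    exact hn (by simpa using tri_edge (hB.inG t (hS ht)) h)
  have herase : ∀ S ⊆ insert (u, v, w) X, S.erase (u, v, w) ⊆ X := by
    intro S hS
    rwa [Finset.subset_insert_iff] at hS
  refine ⟨?_, ?_, ?_, ?_⟩
  · intro t ht
    rw [Finset.mem_insert] at ht
    rcases ht with rfl | ht
    · exact ⟨by simp [huv], Or.inl hu, Or.inl hv⟩
    · obtain ⟨h1, h2, h3⟩ := hB.inG t ht
      exact ⟨Or.inl h1, Or.inl h2, Or.inl h3⟩
  · intro S hS hne
    by_cases ht : (u, v, w) ∈ S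
    · refine ⟨s(u, v), ?_⟩
      have h0 := bd_eq_zero_of_notMem (hnotin _ (herase S hS))
      unfold bd at h0 ⊢
      rw [← Finset.add_sum_erase _ _ ht, h0]
      simp [tri]
    · rw [Finset.subset_insert_iff_of_notMem ht] at hS
      exact hB.r1 S hS hne
  · intro S hS g hg
    by_cases ht : (u, v, w) ∈ S
    · set S' := S.erase (u, v, w) with hS'
      have hSS : S = insert (u, v, w) S' := (Finset.insert_erase ht).symm
      have hE : ES S = tri (u, v, w) ∪ ES S' := by
        rw [hSS, ES, Finset.biUnion_insert]; rfl
      have hT : S.image top = insert s(u, v) (S'.image top) := by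
        rw [hSS, Finset.image_insert]; rfl
      have hS'X := herase S hS
      have hg' := hB.r2 S' hS'X g (by
        intro e he
        rw [Finset.mem_sdiff] at he
        refine hg e ?_
        rw [Finset.mem_sdiff, hE, hT, Finset.mem_insert]
        refine ⟨Finset.mem_union_right _ he.1, ?_⟩
        rintro (rfl | h)
        · exact hnotin S' hS'X he.1
        · exact he.2 h)
      have hside : ∀ e ∈ tri (u, v, w), e ≠ s(u, v) → cob g e = 0 := by
        intro e he hne
        by_cases hm : e ∈ S'.image top
        · obtain ⟨t, ht', rfl⟩ := Finset.mem_image.mp hm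
          exact hg' _ (Finset.mem_biUnion.mpr ⟨t, ht', top_mem_tri t⟩)
        · refine hg e ?_
          rw [Finset.mem_sdiff, hE, hT, Finset.mem_insert]
          exact ⟨Finset.mem_union_left _ he, by tauto⟩
      have h1 := hside s(u, w) (by simp [tri]) (by
        intro h; rw [Sym2.eq_iff] at h; have := hu.ne; have := hv.ne; tauto)
      have h2 := hside s(v, w) (by simp [tri]) (by
        intro h; rw [Sym2.eq_iff] at h; have := hu.ne; have := hv.ne; tauto)
      intro e he
      rw [hE, Finset.mem_union] at he
      rcases he with he | he
      · by_cases hne : e = s(u, v)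
        · subst hne
          simp only [cob, Sym2.lift_mk] at h1 h2 ⊢
          linear_combination h1 + h2 - z2_add_self (g w)
        · exact hside e he hne
      · exact hg' e he
    · rw [Finset.subset_insert_iff_of_notMem ht] at hS
      exact hB.r2 S hS g hg
  · intro t ht t' ht' heq
    rw [Finset.mem_coe, Finset.mem_insert] at ht ht'
    have hX : ∀ t ∈ X, top t ≠ s(u, v) := by
      intro t ht h
      exact hn (by simpa [h] using tri_edge (hB.inG t ht) (top_mem_tri t))
    rcases ht with rfl | ht <;> rcases ht' with rfl | ht'
    · rfl
    · exact absurd heq.symm (hX t' ht')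
    · exact absurd heq (hX t ht)
    · exact hB.r3 ht ht' heq

lemma vs_isV {S : Finset (V × V × V)} {x : V} : x ∈ VS S ↔ ∃ t ∈ S, IsV t x := by
  simp [VS, IsV]

lemma cob_tri {S : Finset (V × V × V)} {g : V → ZMod 2} (hg : ∀ e ∈ ES S, cob g e = 0)
    {t : V × V × V} (ht : t ∈ S) {x : V} (hx : IsV t x) : g x = g t.1 := by
  have key : ∀ a b : ZMod 2, a + b = 0 → b = a := by decide
  have h1 := hg s(t.1, t.2.1) (Finset.mem_biUnion.mpr ⟨t, ht, by simp [tri]⟩)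
  have h2 := hg s(t.1, t.2.2) (Finset.mem_biUnion.mpr ⟨t, ht, by simp [tri]⟩)
  simp only [cob, Sym2.lift_mk] at h1 h2
  rcases hx with rfl | rfl | rfl
  · rfl
  · exact key _ _ h1
  · exact key _ _ h2

lemma mem_tri_isV {t : V × V × V} {e : Sym2 V} (he : e ∈ tri t) {x : V} (hx : x ∈ e) :
    IsV t x := by
  simp only [tri, Finset.mem_insert, Finset.mem_singleton] at he
  rcases he with rfl | rfl | rfl <;> rw [Sym2.mem_iff] at hx <;> unfold IsV <;> tauto

lemma rank_ineq {H : SimpleGraph V} {X : Finset (V × V × V)} (hB : Built H X)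
    (S : Finset (V × V × V)) (hS : S ⊆ X) (W : Finset V)
    (hW : ∀ g : V → ZMod 2, (∀ e ∈ ES S, cob g e = 0) → (∀ x ∈ W, g x = 0) →
      ∀ e, bd S e ≠ 0 → ∀ x ∈ e, g x = 0) :
    (VS S).card + S.card ≤ (ES S).card + W.card := by
  classical
  have hker : ∀ g : V → ZMod 2, (∀ e ∈ ES S \ S.image top, cob g e = 0) →
      (∀ x ∈ W, g x = 0) → ∀ x ∈ VS S, g x = 0 := by
    intro g hg0 hgW x hx
    have hg := hB.r2 S hS g hg0
    by_contra hgx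
    obtain ⟨t, ht, hxt⟩ := vs_isV.mp hx
    set S1 := S.filter (fun t => g t.1 ≠ 0) with hS1
    have hne : S1.Nonempty := ⟨t, by
      rw [hS1, Finset.mem_filter]; exact ⟨ht, by rwa [← cob_tri hg ht hxt]⟩⟩
    obtain ⟨e, he⟩ := hB.r1 S1 ((Finset.filter_subset _ _).trans hS) hne
    have heS1 : e ∈ ES S1 := by
      by_contra h; exact he (bd_eq_zero_of_notMem h)
    obtain ⟨t1, ht1, het1⟩ := Finset.mem_biUnion.mp heS1
    have ht1' := Finset.mem_filter.mp ht1
    obtain ⟨y, hy⟩ : ∃ y, y ∈ e := by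
      induction e using Sym2.ind with
      | _ a b => exact ⟨a, by simp⟩
    have hgy : g y ≠ 0 := by
      rw [cob_tri hg ht1'.1 (mem_tri_isV het1 hy)]; exact ht1'.2
    have hbdS : bd S e = bd S1 e := by
      unfold bd
      symm
      refine Finset.sum_subset (Finset.filter_subset _ _) ?_
      intro t2 ht2 ht2'
      rw [if_neg]
      intro h
      apply ht2'
      rw [hS1, Finset.mem_filter]
      refine ⟨ht2, ?_⟩
      rwa [← cob_tri hg ht2 (mem_tri_isV h hy)]
    exact hgy (hW g hg hgW e (by rwa [hbdS]) y hy)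
  let ext : (VS S → ZMod 2) → V → ZMod 2 := fun g x => if h : x ∈ VS S then g ⟨x, h⟩ else 0
  let Φ : (VS S → ZMod 2) →
      ((↥(ES S \ S.image top) → ZMod 2) × (W → ZMod 2)) :=
    fun g => (fun e => cob (ext g) e, fun x => ext g x)
  have hinj : Function.Injective Φ := by
    intro g1 g2 h
    have hcobadd : ∀ e, cob (fun x => ext g1 x + ext g2 x) e = cob (ext g1) e + cob (ext g2) e := by
      intro e
      induction e using Sym2.ind with
      | _ a b => simp only [cob, Sym2.lift_mk]; ring
    have h0 := hker (fun x => ext g1 x + ext g2 x) (by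
      intro e he
      rw [hcobadd]
      have := congrFun (congrArg Prod.fst h) ⟨e, he⟩
      simp only [Φ] at this
      rw [this, z2_add_self]) (by
      intro x hx
      have := congrFun (congrArg Prod.snd h) ⟨x, hx⟩
      simp only [Φ] at this
      rw [this, z2_add_self])
    funext ⟨x, hx⟩
    have h1 := h0 x hx
    simp only [ext, hx, dif_pos] at h1
    have key : ∀ a b : ZMod 2, a + b = 0 → a = b := by decide
    exact key _ _ h1
  have hc := Fintype.card_le_of_injective Φ hinj
  simp only [Fintype.card_prod, Fintype.card_fun, ZMod.card, Fintype.card_coe] at hc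
  rw [← pow_add, Nat.pow_le_pow_iff_right (by norm_num)] at hc
  have hsub : S.image top ⊆ ES S := by
    intro e he
    obtain ⟨t, ht, rfl⟩ := Finset.mem_image.mp he
    exact Finset.mem_biUnion.mpr ⟨t, ht, top_mem_tri t⟩
  rw [Finset.card_sdiff_of_subset hsub, Finset.card_image_of_injOn
    (hB.r3.mono (by exact_mod_cast hS))] at hc
  have := Finset.card_le_card hsub
  rw [Finset.card_image_of_injOn (hB.r3.mono (by exact_mod_cast hS))] at this
  omega

/-- number of boundary edges -/
def nbd (S : Finset (V × V × V)) : ℕ := ((Finset.univ : Finset (Sym2 V)).filter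
  fun e => bd S e ≠ 0).card

lemma double_edges {H : SimpleGraph V} (S : Finset (V × V × V)) (hS : ∀ t ∈ S, InG H t) :
    2 * (ES S).card ≤ 3 * S.card + nbd S := by
  have h3 : 3 * S.card = ∑ e ∈ ES S, (S.filter fun t => e ∈ tri t).card := by
    have : ∑ t ∈ S, (tri t).card = 3 * S.card := by
      rw [Finset.sum_congr rfl (fun t ht => tri_card (hS t ht))]
      simp [mul_comm]
    rw [← this]
    simp only [Finset.card_eq_sum_ones, Finset.sum_filter]
    rw [Finset.sum_comm]
    refine Finset.sum_congr rfl fun t ht => ?_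
    rw [← Finset.sum_filter]
    refine Finset.sum_congr ?_ fun _ _ => rfl
    ext e
    simp only [Finset.mem_filter, ES, Finset.mem_biUnion]
    exact ⟨fun h => ⟨⟨t, ht, h⟩, h⟩, fun h => h.2⟩
  have h4 : nbd S = ∑ e ∈ ES S, if bd S e ≠ 0 then 1 else 0 := by
    rw [nbd, Finset.sum_boole, Nat.cast_id]
    congr 1
    ext e
    simp only [Finset.mem_filter, Finset.mem_univ, true_and]
    exact ⟨fun h => ⟨by by_contra h'; exact h (bd_eq_zero_of_notMem h'), h⟩, fun h => h.2⟩
  rw [h3, h4, ← Finset.sum_add_distrib, mul_comm, ← smul_eq_mul, ← Finset.sum_const]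
  refine Finset.sum_le_sum fun e he => ?_
  obtain ⟨t, ht, het⟩ := Finset.mem_biUnion.mp he
  have hpos : 0 < (S.filter fun t => e ∈ tri t).card :=
    Finset.card_pos.mpr ⟨t, Finset.mem_filter.mpr ⟨ht, het⟩⟩
  have hbdc : bd S e = ((S.filter fun t => e ∈ tri t).card : ZMod 2) := by
    unfold bd
    rw [Finset.sum_boole]
  by_cases h1 : (S.filter fun t => e ∈ tri t).card = 1
  · rw [hbdc, h1]; simp
  · omega

/-- All small subgraphs are sparse. -/
def Sparse (G : SimpleGraph V) (q N : ℕ) : Prop :=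
  ∀ (U : Finset V) (E : Finset (Sym2 V)), (∀ e ∈ E, e ∈ G.edgeSet ∧ ∀ x ∈ e, x ∈ U) →
    1 ≤ U.card → U.card ≤ N → q * E.card + U.card ≤ 3 * q * U.card

lemma card_VS_le (S : Finset (V × V × V)) : (VS S).card ≤ 3 * S.card := by
  unfold VS
  refine (Finset.card_biUnion_le).trans ?_
  rw [mul_comm, ← smul_eq_mul, ← Finset.sum_const]
  exact Finset.sum_le_sum fun t _ => Finset.card_le_three

lemma ES_in {G : SimpleGraph V} {S : Finset (V × V × V)} (hS : ∀ t ∈ S, InG G t) :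
    ∀ e ∈ ES S, e ∈ G.edgeSet ∧ ∀ x ∈ e, x ∈ VS S := by
  intro e he
  obtain ⟨t, ht, het⟩ := Finset.mem_biUnion.mp he
  exact ⟨tri_edge (hS t ht) het, fun x hx => vs_isV.mpr ⟨t, ht, mem_tri_isV het hx⟩⟩

lemma local_iso {G H : SimpleGraph V} (hHG : H ≤ G) {X : Finset (V × V × V)} (hB : Built H X)
    {q K : ℕ} (hq : 1 ≤ q) (hsp : Sparse G q (3 * K)) (S : Finset (V × V × V)) (hS : S ⊆ X)
    (hK : S.card ≤ K) : S.card ≤ (8 * q + 1) * nbd S := by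
  classical
  rcases S.eq_empty_or_nonempty with rfl | hne
  · simp
  have hin : ∀ t ∈ S, InG H t := fun t ht => hB.inG t (hS ht)
  have hinG : ∀ t ∈ S, InG G t := fun t ht => by
    obtain ⟨h1, h2, h3⟩ := hin t ht
    exact ⟨hHG h1, hHG h2, hHG h3⟩
  have h1 := double_edges S hin
  -- choose an endpoint of every boundary edge
  have h2 : (VS S).card + S.card ≤ (ES S).card + nbd S := by
    let B := (Finset.univ : Finset (Sym2 V)).filter fun e => bd S e ≠ 0
    have hr := rank_ineq hB S hS (B.image fun e => (Quot.out e).1) (by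
      intro g hg hgW e he x hx
      have hBe : e ∈ B := by simp [B, he]
      have h0 := hgW _ (Finset.mem_image_of_mem _ hBe)
      have heS : e ∈ ES S := by by_contra h; exact he (bd_eq_zero_of_notMem h)
      obtain ⟨t, ht, het⟩ := Finset.mem_biUnion.mp heS
      rw [cob_tri hg ht (mem_tri_isV het hx)]
      rw [cob_tri hg ht (mem_tri_isV het (Sym2.out_fst_mem e))] at h0
      exact h0)
    have : (B.image fun e => (Quot.out e).1).card ≤ nbd S := Finset.card_image_le
    omega
  have hv3 := card_VS_le S
  have hv1 : 1 ≤ (VS S).card := by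
    obtain ⟨t, ht⟩ := hne
    exact Finset.card_pos.mpr ⟨t.1, vs_isV.mpr ⟨t, ht, Or.inl rfl⟩⟩
  have hd := hsp (VS S) (ES S) (ES_in hinG) hv1 (by omega)
  -- 3 v ≤ e + 4 b
  have h3 : 3 * (VS S).card ≤ (ES S).card + 4 * nbd S := by omega
  have h4 : (VS S).card ≤ 4 * q * nbd S := by nlinarith
  have h5 : (ES S).card ≤ 3 * (VS S).card := by
    have : q * (ES S).card ≤ q * (3 * (VS S).card) := by nlinarith
    exact Nat.le_of_mul_le_mul_left this (by omega)
  nlinarith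

/-! ### Linear isoperimetry -/

/-- constants -/
def cC (q : ℕ) : ℕ := 2 * (8 * q + 1)
/-- constants -/
def cR (q : ℕ) : ℕ := 128 * cC q
/-- constants -/
def cM (q : ℕ) : ℕ := 8 * cR q
/-- constants -/
def cB (q : ℕ) : ℕ := 4 * (cC q * cR q)
/-- constants -/
def cL (q : ℕ) : ℕ := 8 * cM q
/-- constants -/
def cK (q : ℕ) : ℕ := cC q * (cL q + 2) + 2

/-- Every closed walk bounds a set of linearly many triangles. -/
def Lin (q : ℕ) (H : SimpleGraph V) (X : Finset (V × V × V)) : Prop :=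
  ∀ (u : V) (w : H.Walk u u), ∃ S ⊆ X, (∀ e, bd S e = zw w e) ∧
    (w.length ≤ cL q → S.card ≤ (8 * q + 1) * w.length) ∧
    (cL q < w.length → S.card + cB q ≤ cC q * w.length)

lemma lin_le {q : ℕ} {s x : ℕ} (h1 : x ≤ cL q → s ≤ (8 * q + 1) * x)
    (h2 : cL q < x → s + cB q ≤ cC q * x) : s ≤ cC q * x := by
  rcases le_or_gt x (cL q) with h | h
  · have := h1 h
    unfold cC
    nlinarith
  · have := h2 h
    omega

lemma lin_ge {q : ℕ} {s x : ℕ} (h1 : x ≤ cL q → s ≤ (8 * q + 1) * x)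
    (h2 : cL q < x → s + cB q ≤ cC q * x) (hM : cM q ≤ x) : s + cB q ≤ cC q * x := by
  rcases le_or_gt x (cL q) with h | h
  · have := h1 h
    have h3 : (8 * q + 1) * cM q ≤ (8 * q + 1) * x := Nat.mul_le_mul_left _ hM
    unfold cB cC
    unfold cM at h3
    nlinarith
  · exact h2 h

lemma zw_acyclic {T : SimpleGraph V} (hT : T.IsAcyclic) {u : V} (w : T.Walk u u) (e : Sym2 V) :
    zw w e = 0 := by
  classical
  by_cases he : e ∈ T.edgeSet
  swap
  · unfold zw
    rw [List.count_eq_zero_of_not_mem, Nat.cast_zero]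
    intro h
    exact he (w.edges_subset_edgeSet h)
  have hb := SimpleGraph.isAcyclic_iff_forall_isBridge.mp hT he
  induction e using Sym2.ind with
  | _ a b =>
  rw [SimpleGraph.isBridge_iff] at hb
  let T' := T.deleteEdges {s(a, b)}
  let φ : V → ZMod 2 := fun x => if T'.Reachable a x then 1 else 0
  have hcob : ∀ f ∈ T.edgeSet, cob φ f = if f = s(a, b) then 1 else 0 := by
    intro f hf
    induction f using Sym2.ind with
    | _ x y =>
    simp only [cob, Sym2.lift_mk]
    split_ifs with h
    · have ha : φ a = 1 := by simp [φ]
      have hb' : φ b = 0 := by simp only [φ]; rw [if_neg hb]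
      rcases Sym2.eq_iff.mp h with ⟨rfl, rfl⟩ | ⟨rfl, rfl⟩ <;> rw [ha, hb'] <;> simp
    · have hxy : T'.Adj x y := by
        simp only [T', SimpleGraph.deleteEdges_adj, Set.mem_singleton_iff]
        exact ⟨hf, h⟩
      have : φ x = φ y := by
        simp only [φ]
        congr 1
        exact propext ⟨fun h => h.trans hxy.reachable, fun h => h.trans hxy.symm.reachable⟩
      rw [this]; exact z2_add_self _
  have h0 := zw_pair w (cob φ)
  rw [← Nat.Ico_zero_eq_range, cob_sum w φ 0 w.length (Nat.zero_le _)] at h0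
  simp only [SimpleGraph.Walk.getVert_zero, SimpleGraph.Walk.getVert_length, z2_add_self] at h0
  rw [Finset.sum_eq_single s(a, b)] at h0
  · rw [hcob _ he] at h0
    simpa using h0
  · intro f _ hf
    by_cases hfT : f ∈ T.edgeSet
    · rw [hcob f hfT, if_neg hf, zero_mul]
    · have : zw w f = 0 := by
        unfold zw
        rw [List.count_eq_zero_of_not_mem, Nat.cast_zero]
        intro h
        exact hfT (w.edges_subset_edgeSet h)
      rw [this, mul_zero]
  · simp

lemma lin_base (q : ℕ) {T : SimpleGraph V} (hT : T.IsAcyclic) : Lin q T ∅ := by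
  intro u w
  refine ⟨∅, subset_rfl, ?_, ?_, ?_⟩
  · intro e
    rw [zw_acyclic hT]; simp [bd]
  · simp
  · intro h
    simp only [Finset.card_empty, zero_add]
    have : cC q * cL q ≤ cC q * w.length := Nat.mul_le_mul_left _ h.le
    unfold cB
    unfold cL cM at this
    nlinarith

lemma subst_walk {H : SimpleGraph V} {u v w : V} (huv : u ≠ v) (hu : H.Adj u w) (hv : H.Adj v w)
    {a b : V} (p : (H ⊔ SimpleGraph.fromEdgeSet {s(u, v)}).Walk a b) :
    ∃ (p' : H.Walk a b) (k : ℕ), p'.length = p.length + k ∧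
      (∀ e, zw p' e = zw p e + k * bd {(u, v, w)} e) ∧
      k ≤ p.support.tail.count u + p.support.tail.count v := by
  classical
  have hwu := hu.ne
  have hwv := hv.ne
  have hbd : ∀ e, bd {(u, v, w)} e = (if e = s(u, v) then 1 else 0) +
      (if e = s(u, w) then 1 else 0) + (if e = s(v, w) then (1 : ZMod 2) else 0) := by
    intro e
    simp only [bd, Finset.sum_singleton, tri, Finset.mem_insert, Finset.mem_singleton]
    have h1 : s(u, v) ≠ s(u, w) := by simp; grind
    have h2 : s(u, v) ≠ s(v, w) := by simp; grind
    have h3 : s(u, w) ≠ s(v, w) := by simp; grind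
    by_cases e1 : e = s(u, v)
    · subst e1; simp [h1, h2, -Sym2.eq, -Sym2.eq_iff]
    · by_cases e2 : e = s(u, w)
      · subst e2; simp [h1.symm, h3, -Sym2.eq, -Sym2.eq_iff]
      · simp [e1, e2, -Sym2.eq, -Sym2.eq_iff]
  induction p with
  | nil => exact ⟨SimpleGraph.Walk.nil, 0, by simp, by simp [zw], by simp⟩
  | @cons a b c h p ih =>
    obtain ⟨p', k, h1, h2, h3⟩ := ih
    by_cases hab : H.Adj a b
    · refine ⟨SimpleGraph.Walk.cons hab p', k, by simp [h1]; omega, ?_, ?_⟩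
      · intro e
        have := h2 e
        simp only [zw, SimpleGraph.Walk.edges_cons, List.count_cons, Nat.cast_add] at this ⊢
        linear_combination this
      · refine h3.trans ?_
        simp only [SimpleGraph.Walk.support_cons, List.tail_cons]
        exact Nat.add_le_add ((List.tail_sublist _).count_le _) ((List.tail_sublist _).count_le _)
    · have hs : s(a, b) = s(u, v) := by
        simp only [SimpleGraph.sup_adj, SimpleGraph.fromEdgeSet_adj, Set.mem_singleton_iff] at h
        tauto
      have haw : H.Adj a w := by
        rcases Sym2.eq_iff.mp hs with ⟨rfl, rfl⟩ | ⟨rfl, rfl⟩ <;> assumption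
      have hbw : H.Adj b w := by
        rcases Sym2.eq_iff.mp hs with ⟨rfl, rfl⟩ | ⟨rfl, rfl⟩ <;> assumption
      refine ⟨SimpleGraph.Walk.cons haw (SimpleGraph.Walk.cons hbw.symm p'), k + 1,
        by simp [h1]; omega, ?_, ?_⟩
      · intro e
        have h4 := h2 e
        have h5 : (if e = s(u, w) then 1 else 0) + (if e = s(v, w) then (1 : ZMod 2) else 0)
          = (if e = s(a, w) then 1 else 0) + (if e = s(b, w) then (1 : ZMod 2) else 0) := by
          rcases Sym2.eq_iff.mp hs with ⟨rfl, rfl⟩ | ⟨rfl, rfl⟩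
          · rfl
          · rw [add_comm]
        have h6 := z2_add_self (if e = s(u, v) then (1 : ZMod 2) else 0)
        have h7 := hbd e
        simp only [zw, SimpleGraph.Walk.edges_cons, List.count_cons, Nat.cast_add, hs,
          beq_iff_eq, Nat.cast_ite, Nat.cast_one, Nat.cast_zero, eq_comm (b := e)] at h4 ⊢
        rw [Sym2.eq_swap (a := w) (b := b)]
        linear_combination h4 - h5 - h6 - h7
      · simp only [SimpleGraph.Walk.support_cons, List.tail_cons]
        rw [← SimpleGraph.Walk.cons_tail_support p] 
        simp only [List.count_cons]
        have : b = u ∨ b = v := by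
          rcases Sym2.eq_iff.mp hs with ⟨rfl, rfl⟩ | ⟨rfl, rfl⟩ <;> simp
        rcases this with rfl | rfl
        · simp; omega
        · simp; omega

lemma nbd_le_length {H : SimpleGraph V} {a b : V} (w : H.Walk a b) {S : Finset (V × V × V)}
    (h : ∀ e, bd S e = zw w e) : nbd S ≤ w.length := by
  classical
  rw [← w.length_edges]
  refine le_trans (Finset.card_le_card ?_) (List.toFinset_card_le w.edges)
  intro e he
  simp only [Finset.mem_filter, Finset.mem_univ, true_and, h] at he
  rw [List.mem_toFinset]
  by_contra hn
  apply he
  unfold zw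
  rw [List.count_eq_zero_of_not_mem hn, Nat.cast_zero]

lemma tail_nodup {H : SimpleGraph V} {a b : V} (w : H.Walk a b)
    (h : ∀ i j, 1 ≤ i → i < j → j ≤ w.length → w.getVert i ≠ w.getVert j) :
    w.support.tail.Nodup := by
  rw [List.nodup_iff_injective_get]
  intro ⟨i, hi⟩ ⟨j, hj⟩ hij
  simp only [List.length_tail, SimpleGraph.Walk.length_support] at hi hj
  simp only [List.get_eq_getElem, List.getElem_tail,
    ← SimpleGraph.Walk.getVert_eq_support_getElem] at hij
  rw [← SimpleGraph.Walk.getVert_eq_support_getElem _ (by omega), 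
    ← SimpleGraph.Walk.getVert_eq_support_getElem _ (by omega)] at hij
  rcases lt_trichotomy i j with hl | hl | hl
  · exact absurd hij (h _ _ (by omega) (by omega) (by omega))
  · simp [hl]
  · exact absurd hij.symm (h _ _ (by omega) (by omega) (by omega))

lemma lin_step {q : ℕ} (hq : 1 ≤ q) {G H : SimpleGraph V} {X : Finset (V × V × V)} {u v w : V}
    (hB : Built H X) (hlin : Lin q H X) (huv : u ≠ v) (hn : ¬ H.Adj u v)
    (hu : H.Adj u w) (hv : H.Adj v w)
    (hG : H ⊔ SimpleGraph.fromEdgeSet {s(u, v)} ≤ G) (hsp : Sparse G q (3 * cK q)) :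
    Lin q (H ⊔ SimpleGraph.fromEdgeSet {s(u, v)}) (insert (u, v, w) X) := by
  classical
  have hB' := built_step hB huv hn hu hv
  set H' := H ⊔ SimpleGraph.fromEdgeSet {s(u, v)} with hH'
  set X' := insert (u, v, w) X with hX'
  have main : ∀ (x : ℕ) (a : V) (p : H'.Walk a a), p.length = x → ∃ S ⊆ X',
      (∀ e, bd S e = zw p e) ∧
      (p.length ≤ cL q → S.card ≤ (8 * q + 1) * p.length) ∧
      (cL q < p.length → S.card + cB q ≤ cC q * p.length) := by
    intro x
    induction x using Nat.strong_induction_on with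
    | _ x ih =>
    intro a p hp
    by_cases hrep : ∃ i j, 1 ≤ i ∧ i < j ∧ j ≤ p.length ∧ p.getVert i = p.getVert j
    · obtain ⟨i, j, hi, hij, hj, heq⟩ := hrep
      obtain ⟨y, w1, w2, hl1, hl2, hz⟩ := split_walk p i j hij.le hj
        ((SimpleGraph.Walk.nil : H'.Walk (p.getVert i) (p.getVert i)).copy rfl heq)
      simp only [SimpleGraph.Walk.length_copy, SimpleGraph.Walk.length_nil, add_zero] at hl1 hl2
      obtain ⟨S1, hS1, hb1, ha1, hc1⟩ := ih w1.length (by omega) y w1 rfl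
      obtain ⟨S2, hS2, hb2, ha2, hc2⟩ := ih w2.length (by omega) a w2 rfl
      have hlen : p.length = w1.length + w2.length := by omega
      have hcard := card_symmDiff_le' S1 S2
      refine ⟨symmDiff S1 S2, symmDiff_sub hS1 hS2, ?_, ?_, ?_⟩
      · intro e; rw [bd_symmDiff, hb1, hb2, hz]
      · intro h
        have h1 := ha1 (by omega)
        have h2 := ha2 (by omega)
        rw [hlen, mul_add]; omega
      · intro h
        have h1 := lin_le ha1 hc1
        have h2 := lin_le ha2 hc2
        rw [hlen, mul_add]
        have : cM q ≤ w1.length ∨ cM q ≤ w2.length := by unfold cL at h; omega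
        rcases this with h3 | h3
        · have := lin_ge ha1 hc1 h3; omega
        · have := lin_ge ha2 hc2 h3; omega
    · have hnd : p.support.tail.Nodup := tail_nodup p (by
        intro i j h1 h2 h3 h4; exact hrep ⟨i, j, h1, h2, h3, h4⟩)
      obtain ⟨p', k, hl, hz, hk⟩ := subst_walk huv hu hv p
      have hk2 : k ≤ 2 := by
        have h1 := List.nodup_iff_count_le_one.mp hnd u
        have h2 := List.nodup_iff_count_le_one.mp hnd v
        omega
      have hex : ∃ S ⊆ X', (∀ e, bd S e = zw p e) ∧ S.card ≤ cC q * (p.length + 2) + 2 := by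
        obtain ⟨S0, hS0, hb0, ha0, hc0⟩ := hlin a p'
        have hS0c := lin_le ha0 hc0
        have hle : cC q * p'.length ≤ cC q * (p.length + 2) := Nat.mul_le_mul_left _ (by omega)
        have hS0' : S0 ⊆ X' := hS0.trans (Finset.subset_insert _ _)
        by_cases hk1 : k = 1
        · refine ⟨symmDiff S0 {(u, v, w)}, symmDiff_sub hS0' (by simp [hX']), ?_, ?_⟩
          · intro e
            rw [bd_symmDiff, hb0, hz, hk1]
            have := z2_add_self (bd {(u, v, w)} e)
            push_cast
            linear_combination this
          · have := card_symmDiff_le' S0 {(u, v, w)}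
            simp only [Finset.card_singleton] at this
            omega
        · refine ⟨S0, hS0', ?_, by omega⟩
          intro e
          rw [hb0, hz]
          have : ((k : ℕ) : ZMod 2) = 0 := by
            have : k = 0 ∨ k = 2 := by omega
            rcases this with rfl | rfl <;> decide
          rw [this]; ring
      obtain ⟨S, hS, hb, hc⟩ := hex
      rcases le_or_gt p.length (cL q) with hx | hx
      · refine ⟨S, hS, hb, fun _ => ?_, fun h => absurd h (by omega)⟩
        have hSK : S.card ≤ cK q := by
          unfold cK
          have : cC q * (p.length + 2) ≤ cC q * (cL q + 2) := Nat.mul_le_mul_left _ (by omega)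
          omega
        exact (local_iso hG hB' hq hsp S hS hSK).trans
          (Nat.mul_le_mul_left _ (nbd_le_length p hb))
      · by_cases hch : ∃ i j, cM q + i ≤ j ∧ j + cM q ≤ p.length + i ∧ j ≤ p.length ∧
          ∃ P : H'.Walk (p.getVert i) (p.getVert j), P.length ≤ 2 * cR q
        · obtain ⟨i, j, h1, h2, h3, P, hP⟩ := hch
          have hRpos : 1 ≤ cR q := by unfold cR cC; omega
          have hMR : cM q = 8 * cR q := rfl
          obtain ⟨y, w1, w2, hl1, hl2, hzz⟩ := split_walk p i j (by omega) h3 P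
          obtain ⟨S1, hS1, hb1, ha1, hc1⟩ := ih w1.length (by omega) y w1 rfl
          obtain ⟨S2, hS2, hb2, ha2, hc2⟩ := ih w2.length (by omega) a w2 rfl
          have hcard := card_symmDiff_le' S1 S2
          refine ⟨symmDiff S1 S2, symmDiff_sub hS1 hS2, ?_, fun h => absurd h (by omega), ?_⟩
          · intro e; rw [bd_symmDiff, hb1, hb2, hzz]
          · intro _
            have e1 := lin_ge ha1 hc1 (by omega)
            have e2 := lin_ge ha2 hc2 (by omega)
            have e3 : w1.length + w2.length ≤ p.length + 4 * cR q := by omega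
            have e4 : cC q * (w1.length + w2.length) ≤ cC q * (p.length + 4 * cR q) :=
              Nat.mul_le_mul_left _ e3
            have e5 : cC q * (p.length + 4 * cR q) = cC q * p.length + cB q := by unfold cB; ring
            rw [mul_add] at e4
            omega
        · exfalso
          have hnc := no_chord_area p S (fun t ht => hB'.inG t (hS ht)) hb (cR q) (cM q) (by
            intro i j h1 h2 h3 P
            by_contra h4
            exact hch ⟨i, j, h1, h2, h3, P, by omega⟩)
          have hxM : 8 * cM q < p.length := hx
          have hMR : cM q = 8 * cR q := rfl
          have hRC : cR q = 128 * cC q := rfl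
          have hCpos : 2 ≤ cC q := by unfold cC; omega
          obtain ⟨y, hy⟩ : ∃ y, p.length = y + 4 * cM q := ⟨p.length - 4 * cM q, by omega⟩
          rw [hy, Nat.add_sub_cancel] at hnc
          rw [hMR] at hnc
          have h1 : y * cR q ≤ 16 * S.card := by
            have : cR q * (y * cR q) ≤ cR q * (16 * S.card) := by nlinarith
            exact Nat.le_of_mul_le_mul_left this (by omega)
          have hpy : p.length + 4 ≤ 2 * y + 4 := by omega
          have h2 : S.card ≤ cC q * (2 * y + 2) + 2 := by
            refine hc.trans ?_
            have : cC q * (p.length + 2) ≤ cC q * (2 * y + 2) := Nat.mul_le_mul_left _ (by omega)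
            omega
          have hy1 : 1 ≤ y := by omega
          rw [hRC] at h1
          nlinarith
  intro a p
  exact main p.length a p rfl

lemma lin_final {q : ℕ} (hq : 1 ≤ q) {G T : SimpleGraph V} (hT : T.IsAcyclic) (hTG : T ≤ G)
    (hsp : Sparse G q (3 * cK q)) {H : SimpleGraph V}
    (h : Relation.ReflTransGen (BootStep G) T H) :
    H ≤ G ∧ ∃ X, Built H X ∧ Lin q H X := by
  induction h with
  | refl => exact ⟨hTG, ∅, built_nil T, lin_base q hT⟩
  | @tail A _ _ hs ih =>
    obtain ⟨hG, X, hB, hl⟩ := ih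
    obtain ⟨u, v, huv, hn, rfl, w, hu, hv⟩ := hs
    have hle : A ⊔ SimpleGraph.fromEdgeSet {s(u, v)} ≤ G := by
      refine sup_le hG ?_
      intro a b hab
      simp only [SimpleGraph.fromEdgeSet_adj, Set.mem_singleton_iff] at hab
      have : s(a, b) ∈ G.edgeSet := by rw [hab.1]; exact huv
      exact this
    exact ⟨hle, insert (u, v, w) X, built_step hB huv.ne hn hu hv,
      lin_step hq hB hl huv.ne hn hu hv hle hsp⟩

/-- Every four-cycle lies in a small dense subgraph. -/
lemma four_cycle {q : ℕ} (hq : 1 ≤ q) {G T : SimpleGraph V} (hT : T.IsAcyclic) (hTG : T ≤ G)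
    (hsp : Sparse G q (3 * cK q)) (h : Relation.ReflTransGen (BootStep G) T G)
    {a b c d : V} (hab : G.Adj a b) (hbc : G.Adj b c) (hcd : G.Adj c d) (hda : G.Adj d a)
    (hac : a ≠ c) (hbd : b ≠ d) :
    ∃ (U : Finset V) (E : Finset (Sym2 V)), a ∈ U ∧ b ∈ U ∧ c ∈ U ∧ d ∈ U ∧
      (∀ e ∈ E, e ∈ G.edgeSet ∧ ∀ x ∈ e, x ∈ U) ∧ U.card ≤ 12 * (8 * q + 1) ∧
      3 * U.card ≤ E.card + 7 := by
  classical
  obtain ⟨-, X, hB, hl⟩ := lin_final hq hT hTG hsp h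
  let w : G.Walk a a := .cons hab (.cons hbc (.cons hcd (.cons hda .nil)))
  obtain ⟨S, hS, hb, hc, -⟩ := hl a w
  have hw4 : w.length = 4 := by simp [w]
  have hS4 : S.card ≤ (8 * q + 1) * 4 := by
    rw [← hw4]; apply hc; rw [hw4]; unfold cL cM cR cC; omega
  have hin : ∀ t ∈ S, InG G t := fun t ht => hB.inG t (hS ht)
  have hE := ES_in hin
  have hz : ∀ e ∈ w.edges, bd S e ≠ 0 := by
    intro e he
    rw [hb]
    have hnd : w.edges.Nodup := by
      have := hab.ne; have := hbc.ne; have := hcd.ne; have := hda.ne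
      simp only [w, SimpleGraph.Walk.edges_cons, SimpleGraph.Walk.edges_nil, List.nodup_cons,
        List.mem_cons, List.not_mem_nil, Sym2.eq_iff, not_or, or_false, List.nodup_nil]
      grind
    unfold zw
    rw [List.count_eq_one_of_mem hnd he]
    simp
  have hES : ∀ e ∈ w.edges, e ∈ ES S := by
    intro e he
    by_contra hn
    exact hz e he (bd_eq_zero_of_notMem hn)
  have e1 : s(a, b) ∈ ES S := hES _ (by simp [w])
  have e2 : s(b, c) ∈ ES S := hES _ (by simp [w])
  have e3 : s(c, d) ∈ ES S := hES _ (by simp [w])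
  have e4 : s(d, a) ∈ ES S := hES _ (by simp [w])
  have hr := rank_ineq hB S hS {a} (by
    intro g hg hgW e he x hx
    have ga : g a = 0 := hgW a (by simp)
    have f1 := hg _ e1
    have f2 := hg _ e2
    have f4 := hg _ e4
    simp only [cob, Sym2.lift_mk, ga, zero_add, add_zero] at f1 f2 f4
    rw [f1, zero_add] at f2
    have hew : e ∈ w.edges := by
      by_contra hn
      apply he
      rw [hb]
      unfold zw
      rw [List.count_eq_zero_of_not_mem hn, Nat.cast_zero]
    simp only [w, SimpleGraph.Walk.edges_cons, SimpleGraph.Walk.edges_nil,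
        List.mem_cons, List.not_mem_nil, or_false] at hew
    rcases hew with rfl | rfl | rfl | rfl <;> rcases Sym2.mem_iff.mp hx with rfl | rfl <;>
      assumption)
  have hd := double_edges S hin
  have hn := nbd_le_length w hb
  have hv := card_VS_le S
  rw [Finset.card_singleton] at hr
  refine ⟨VS S, ES S, (hE _ e1).2 _ (by simp), (hE _ e1).2 _ (by simp), (hE _ e3).2 _ (by simp),
    (hE _ e3).2 _ (by simp), hE, by omega, by omega⟩

/-- Edges outside the tree lie in triangles. -/
lemma edge_tri {G T H : SimpleGraph V} (hTG : T ≤ G)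
    (h : Relation.ReflTransGen (BootStep G) T H) :
    H ≤ G ∧ ∀ u v, H.Adj u v → T.Adj u v ∨ ∃ w, G.Adj u v ∧ G.Adj u w ∧ G.Adj v w := by
  induction h with
  | refl => exact ⟨hTG, fun u v h => Or.inl h⟩
  | tail _ hs ih =>
    obtain ⟨hG, hX⟩ := ih
    obtain ⟨u, v, huv, hn, rfl, w, hu, hv⟩ := hs
    constructor
    · refine sup_le hG ?_
      intro a b hab
      simp only [SimpleGraph.fromEdgeSet_adj, Set.mem_singleton_iff] at hab
      have : s(a, b) ∈ G.edgeSet := by rw [hab.1]; exact huv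
      exact this
    · intro a b hab
      rw [SimpleGraph.sup_adj] at hab
      rcases hab with hab | hab
      · exact hX a b hab
      · right
        simp only [SimpleGraph.fromEdgeSet_adj, Set.mem_singleton_iff] at hab
        rcases Sym2.eq_iff.mp hab.1 with ⟨rfl, rfl⟩ | ⟨rfl, rfl⟩
        · exact ⟨w, huv, hG hu, hG hv⟩
        · exact ⟨w, huv.symm, hG hv, hG hu⟩

/-! ### Probability in the binomial random graph -/

/-- weight of a graph -/
noncomputable def wt (n : ℕ) (p : ℝ) (G : SimpleGraph (Fin n)) : ℝ :=
  p ^ edgeCard G * (1 - p) ^ (n.choose 2 - edgeCard G)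

/-- expectation -/
noncomputable def Ex (n : ℕ) (p : ℝ) (f : SimpleGraph (Fin n) → ℝ) : ℝ :=
  ∑ G : SimpleGraph (Fin n), wt n p G * f G

/-- all possible edges -/
def Om (n : ℕ) : Finset (Sym2 (Fin n)) := Finset.univ.filter fun e => ¬ e.IsDiag

open scoped Classical in
/-- indicator that all edges of `E` are present and those of `D` absent -/
noncomputable def ind {n : ℕ} (E D : Finset (Sym2 (Fin n))) (G : SimpleGraph (Fin n)) : ℝ :=
  if (∀ e ∈ E, e ∈ G.edgeSet) ∧ (∀ e ∈ D, e ∉ G.edgeSet) then 1 else 0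

lemma ind_nonneg {n : ℕ} (E D : Finset (Sym2 (Fin n))) (G : SimpleGraph (Fin n)) :
    0 ≤ ind E D G := by
  unfold ind; split_ifs <;> norm_num

lemma ind_mul {n : ℕ} (E D E' D' : Finset (Sym2 (Fin n))) (G : SimpleGraph (Fin n)) :
    ind E D G * ind E' D' G = ind (E ∪ E') (D ∪ D') G := by
  unfold ind
  have h : ((∀ e ∈ E ∪ E', e ∈ G.edgeSet) ∧ (∀ e ∈ D ∪ D', e ∉ G.edgeSet)) ↔
      ((∀ e ∈ E, e ∈ G.edgeSet) ∧ (∀ e ∈ D, e ∉ G.edgeSet)) ∧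
      ((∀ e ∈ E', e ∈ G.edgeSet) ∧ (∀ e ∈ D', e ∉ G.edgeSet)) := by
    constructor
    · rintro ⟨h1, h2⟩
      exact ⟨⟨fun e he => h1 e (Finset.mem_union_left _ he),
        fun e he => h2 e (Finset.mem_union_left _ he)⟩,
        ⟨fun e he => h1 e (Finset.mem_union_right _ he),
        fun e he => h2 e (Finset.mem_union_right _ he)⟩⟩
    · rintro ⟨⟨h1, h2⟩, h3, h4⟩
      exact ⟨fun e he => (Finset.mem_union.mp he).elim (h1 e) (h3 e),
        fun e he => (Finset.mem_union.mp he).elim (h2 e) (h4 e)⟩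
  by_cases h1 : (∀ e ∈ E, e ∈ G.edgeSet) ∧ (∀ e ∈ D, e ∉ G.edgeSet)
  · by_cases h2 : (∀ e ∈ E', e ∈ G.edgeSet) ∧ (∀ e ∈ D', e ∉ G.edgeSet)
    · rw [if_pos h1, if_pos h2, if_pos (h.mpr ⟨h1, h2⟩), one_mul]
    · rw [if_neg h2, if_neg (fun h3 => h2 (h.mp h3).2), mul_zero]
  · rw [if_neg h1, if_neg (fun h3 => h1 (h.mp h3).1), zero_mul]

lemma card_Om (n : ℕ) : (Om n).card = n.choose 2 := by
  have := Sym2.card_subtype_not_diag (α := Fin n)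
  rw [Fintype.card_fin] at this
  rw [← this, Fintype.card_subtype]
  rfl

lemma wt_nonneg {n : ℕ} {p : ℝ} (h0 : 0 ≤ p) (h1 : p ≤ 1) (G : SimpleGraph (Fin n)) :
    0 ≤ wt n p G := by
  unfold wt
  have : 0 ≤ 1 - p := by linarith
  positivity

lemma Ex_ind {n : ℕ} (p : ℝ) (E D : Finset (Sym2 (Fin n))) (hE : E ⊆ Om n) (hD : D ⊆ Om n)
    (hED : Disjoint E D) : Ex n p (ind E D) = p ^ E.card * (1 - p) ^ D.card := by
  classical
  have hcard : (Om n \ (E ∪ D)).card + E.card + D.card = n.choose 2 := by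
    rw [← card_Om, add_assoc, ← Finset.card_union_of_disjoint hED,
      Finset.card_sdiff_add_card_eq_card (Finset.union_subset hE hD)]
  have hes : ∀ A ⊆ Om n, (SimpleGraph.fromEdgeSet (A : Set (Sym2 (Fin n)))).edgeSet = A := by
    intro A hA
    rw [SimpleGraph.edgeSet_fromEdgeSet]
    ext e
    simp only [Set.mem_sdiff, Finset.mem_coe]
    constructor
    · exact fun h => h.1
    · intro h
      refine ⟨h, ?_⟩
      have := hA h
      simpa [Om] using this
  have hec : ∀ A ⊆ Om n, edgeCard (SimpleGraph.fromEdgeSet (A : Set (Sym2 (Fin n)))) = A.card := by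
    intro A hA
    unfold edgeCard
    rw [hes A hA]
    simp
  have hEB : ∀ B ⊆ Om n \ (E ∪ D), E ∪ B ⊆ Om n := fun B hB =>
    Finset.union_subset hE (hB.trans Finset.sdiff_subset)
  have hEB2 : ∀ B ⊆ Om n \ (E ∪ D), (E ∪ B).card = E.card + B.card := by
    intro B hB
    apply Finset.card_union_of_disjoint
    rw [Finset.disjoint_left]
    intro e he heB
    have := hB heB
    simp [he] at this
  have h1 : Ex n p (ind E D) = ∑ B ∈ (Om n \ (E ∪ D)).powerset,
      p ^ (E.card + B.card) * (1 - p) ^ (n.choose 2 - (E.card + B.card)) := by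
    unfold Ex
    symm
    rw [← Finset.sum_filter_of_ne (p := fun G : SimpleGraph (Fin n) =>
      (∀ e ∈ E, e ∈ G.edgeSet) ∧ (∀ e ∈ D, e ∉ G.edgeSet))]
    swap
    · intro G _ h
      by_contra hn
      apply h
      unfold ind
      rw [if_neg hn, mul_zero]
    refine Finset.sum_bij' (fun B _ => SimpleGraph.fromEdgeSet ((E ∪ B : Finset _) : Set _))
      (fun G _ => (Om n).filter (fun e => e ∈ G.edgeSet) \ (E ∪ D)) ?_ ?_ ?_ ?_ ?_
    · intro B hB
      rw [Finset.mem_powerset] at hB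
      simp only [Finset.mem_filter, Finset.mem_univ, true_and]
      rw [hes _ (hEB B hB)]
      refine ⟨fun e he => by simp [he], fun e he => ?_⟩
      simp only [Finset.coe_union, Set.mem_union, Finset.mem_coe, not_or]
      refine ⟨fun h => Finset.disjoint_left.mp hED h he, fun h => ?_⟩
      have := hB h
      simp [he] at this
    · intro G hG
      rw [Finset.mem_powerset]
      exact Finset.sdiff_subset_sdiff (Finset.filter_subset _ _) subset_rfl
    · intro B hB
      rw [Finset.mem_powerset] at hB
      have hh := hes _ (hEB B hB)
      ext e
      simp only [Finset.mem_sdiff, Finset.mem_filter, hh, Finset.mem_coe, Finset.mem_union]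
      constructor
      · tauto
      · intro h
        have := hB h
        simp only [Finset.mem_sdiff, Finset.mem_union] at this
        tauto
    · intro G hG
      simp only [Finset.mem_filter, Finset.mem_univ, true_and] at hG
      rw [← SimpleGraph.edgeSet_inj, hes]
      · ext e
        simp only [Finset.mem_coe, Finset.mem_union, Finset.mem_sdiff, Finset.mem_filter]
        constructor
        · rintro (h | h)
          · exact hG.1 e h
          · exact h.1.2
        · intro h
          by_cases heE : e ∈ E
          · exact Or.inl heE
          · right
            refine ⟨⟨?_, h⟩, ?_⟩
            · simp only [Om, Finset.mem_filter, Finset.mem_univ, true_and]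
              exact SimpleGraph.not_isDiag_of_mem_edgeSet G h
            · intro h2
              exact h2.elim heE (fun h2 => hG.2 e h2 h)
      · exact Finset.union_subset hE (Finset.sdiff_subset.trans (Finset.filter_subset _ _))
    · intro B hB
      rw [Finset.mem_powerset] at hB
      unfold wt ind
      rw [hec _ (hEB B hB), hEB2 B hB, if_pos, mul_one]
      rw [hes _ (hEB B hB)]
      refine ⟨fun e he => by simp [he], fun e he => ?_⟩
      simp only [Finset.coe_union, Set.mem_union, Finset.mem_coe, not_or]
      refine ⟨fun h => Finset.disjoint_left.mp hED h he, fun h => ?_⟩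
      have := hB h
      simp [he] at this
  rw [h1]
  have h2 := Finset.sum_pow_mul_eq_add_pow p (1 - p) (Om n \ (E ∪ D))
  rw [add_sub_cancel, one_pow] at h2
  calc _ = ∑ B ∈ (Om n \ (E ∪ D)).powerset, p ^ E.card * (1 - p) ^ D.card *
        (p ^ B.card * (1 - p) ^ ((Om n \ (E ∪ D)).card - B.card)) := by
        refine Finset.sum_congr rfl fun B hB => ?_
        have := Finset.card_le_card (Finset.mem_powerset.mp hB)
        have : n.choose 2 - (E.card + B.card) = D.card + ((Om n \ (E ∪ D)).card - B.card) := by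
          omega
        rw [this, pow_add, pow_add]; ring
    _ = _ := by rw [← Finset.mul_sum, h2, mul_one]

lemma Ex_mono {n : ℕ} {p : ℝ} (h0 : 0 ≤ p) (h1 : p ≤ 1) {f g : SimpleGraph (Fin n) → ℝ}
    (h : ∀ G, f G ≤ g G) : Ex n p f ≤ Ex n p g :=
  Finset.sum_le_sum fun G _ => mul_le_mul_of_nonneg_left (h G) (wt_nonneg h0 h1 G)

lemma Ex_sum {n : ℕ} {p : ℝ} {ι : Type*} (I : Finset ι) (f : ι → SimpleGraph (Fin n) → ℝ) :
    Ex n p (fun G => ∑ i ∈ I, f i G) = ∑ i ∈ I, Ex n p (f i) := by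
  unfold Ex
  simp only [Finset.mul_sum]
  rw [Finset.sum_comm]

lemma Ex_const (n : ℕ) (p c : ℝ) : Ex n p (fun _ => c) = c := by
  have := Ex_ind (n := n) p ∅ ∅ (by simp) (by simp) (by simp)
  unfold Ex ind at *
  simp only [Finset.card_empty, pow_zero, mul_one] at this
  rw [← Finset.sum_mul]
  simp at this
  rw [this, one_mul]

open scoped Classical in
lemma prob_eq (n : ℕ) (p : ℝ) (A : Set (SimpleGraph (Fin n))) :
    gnpProb n p A = Ex n p (fun G => if G ∈ A then 1 else 0) := by
  unfold gnpProb Ex wt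
  refine Finset.sum_congr rfl fun G _ => ?_
  by_cases h : G ∈ A <;> simp [h]

lemma prob_mono {n : ℕ} {p : ℝ} (h0 : 0 ≤ p) (h1 : p ≤ 1) {A B : Set (SimpleGraph (Fin n))}
    (h : A ⊆ B) : gnpProb n p A ≤ gnpProb n p B := by
  classical
  rw [prob_eq, prob_eq]
  refine Ex_mono h0 h1 fun G => ?_
  by_cases hA : G ∈ A
  · simp [hA, h hA]
  · simp only [hA, if_false]; split_ifs <;> norm_num

lemma prob_union {n : ℕ} {p : ℝ} (h0 : 0 ≤ p) (h1 : p ≤ 1) (A B : Set (SimpleGraph (Fin n))) :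
    gnpProb n p (A ∪ B) ≤ gnpProb n p A + gnpProb n p B := by
  classical
  rw [prob_eq, prob_eq, prob_eq]
  have : Ex n p (fun G => if G ∈ A then (1 : ℝ) else 0) + Ex n p (fun G => if G ∈ B then 1 else 0)
      = Ex n p (fun G => (if G ∈ A then (1 : ℝ) else 0) + (if G ∈ B then 1 else 0)) := by
    unfold Ex
    rw [← Finset.sum_add_distrib]
    simp only [mul_add]
  rw [this]
  refine Ex_mono h0 h1 fun G => ?_
  simp only [Set.mem_union]
  by_cases hA : G ∈ A <;> by_cases hB : G ∈ B <;> simp [hA, hB]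

lemma prob_compl {n : ℕ} {p : ℝ} (A : Set (SimpleGraph (Fin n))) :
    gnpProb n p Aᶜ = 1 - gnpProb n p A := by
  classical
  rw [prob_eq, prob_eq, eq_sub_iff_add_eq]
  refine Eq.trans ?_ (Ex_const n p 1)
  unfold Ex
  rw [← Finset.sum_add_distrib]
  refine Finset.sum_congr rfl fun G _ => ?_
  by_cases hA : G ∈ A <;> simp [hA]

lemma prob_nonneg {n : ℕ} {p : ℝ} (h0 : 0 ≤ p) (h1 : p ≤ 1) (A : Set (SimpleGraph (Fin n))) :
    0 ≤ gnpProb n p A := by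
  classical
  rw [prob_eq]
  refine Finset.sum_nonneg fun G _ => mul_nonneg (wt_nonneg h0 h1 G) ?_
  dsimp only
  split_ifs <;> norm_num

lemma markov {n : ℕ} {p : ℝ} (h0 : 0 ≤ p) (h1 : p ≤ 1) {f : SimpleGraph (Fin n) → ℝ}
    (hf : ∀ G, 0 ≤ f G) {m l : ℝ} (hm : Ex n p f ≤ m) (hl : 0 < l) :
    gnpProb n p {G | l ≤ f G} ≤ m / l := by
  classical
  rw [le_div_iff₀ hl]
  refine le_trans ?_ hm
  rw [prob_eq, Ex, Finset.sum_mul]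
  refine Finset.sum_le_sum fun G _ => ?_
  rw [mul_assoc]
  refine mul_le_mul_of_nonneg_left ?_ (wt_nonneg h0 h1 G)
  simp only [Set.mem_ofPred_eq]
  split_ifs with h
  · linarith
  · simpa using hf G

lemma chebyshev {n : ℕ} {p : ℝ} (h0 : 0 ≤ p) (h1 : p ≤ 1) {f : SimpleGraph (Fin n) → ℝ}
    {m v l : ℝ} (hm : Ex n p f = m) (hv : Ex n p (fun G => f G * f G) ≤ m ^ 2 + v) (hl : 0 < l) :
    gnpProb n p {G | f G ≤ m - l} ≤ v / l ^ 2 := by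
  have hE : Ex n p (fun G => (f G - m) ^ 2) ≤ v := by
    have : Ex n p (fun G => (f G - m) ^ 2) = Ex n p (fun G => f G * f G) - 2 * m * Ex n p f
        + Ex n p (fun _ => m ^ 2) := by
      unfold Ex
      rw [Finset.mul_sum, ← Finset.sum_sub_distrib, ← Finset.sum_add_distrib]
      refine Finset.sum_congr rfl fun G _ => ?_
      ring
    rw [this, hm, Ex_const]
    linarith
  refine le_trans (prob_mono h0 h1 ?_) (markov h0 h1 (fun G => sq_nonneg (f G - m)) hE
    (by positivity : 0 < l ^ 2))
  intro G hG
  simp only [Set.mem_ofPred_eq] at hG ⊢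
  nlinarith

/-- counting variable -/
noncomputable def cnt {n : ℕ} {ι : Type*} (I : Finset ι) (E : ι → Finset (Sym2 (Fin n)))
    (G : SimpleGraph (Fin n)) : ℝ := ∑ i ∈ I, ind (E i) ∅ G

lemma Ex_cnt {n : ℕ} (p : ℝ) {ι : Type*} (I : Finset ι) (E : ι → Finset (Sym2 (Fin n)))
    (hE : ∀ i ∈ I, E i ⊆ Om n) : Ex n p (cnt I E) = ∑ i ∈ I, p ^ (E i).card := by
  unfold cnt
  rw [Ex_sum]
  refine Finset.sum_congr rfl fun i hi => ?_
  rw [Ex_ind p _ _ (hE i hi) (by simp) (by simp)]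
  simp

lemma Ex_cnt_sq {n : ℕ} (p : ℝ) {ι : Type*} (I : Finset ι) (E : ι → Finset (Sym2 (Fin n)))
    (hE : ∀ i ∈ I, E i ⊆ Om n) :
    Ex n p (fun G => cnt I E G * cnt I E G) = ∑ i ∈ I, ∑ j ∈ I, p ^ (E i ∪ E j).card := by
  unfold cnt
  simp only [Finset.sum_mul_sum, ind_mul]
  rw [Ex_sum]
  refine Finset.sum_congr rfl fun i hi => ?_
  rw [Ex_sum]
  refine Finset.sum_congr rfl fun j hj => ?_
  rw [Ex_ind p _ _ (Finset.union_subset (hE i hi) (hE j hj)) (by simp) (by simp)]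
  simp

open scoped Classical in
lemma cnt_eq {n : ℕ} {ι : Type*} (I : Finset ι) (E : ι → Finset (Sym2 (Fin n)))
    (G : SimpleGraph (Fin n)) :
    cnt I E G = ((I.filter fun i => ∀ e ∈ E i, e ∈ G.edgeSet).card : ℝ) := by
  unfold cnt ind
  simp

/-! ### Small dense subgraphs -/

/-- possible edges inside `U` -/
def KU {n : ℕ} (U : Finset (Fin n)) : Finset (Sym2 (Fin n)) :=
  (Om n).filter fun e => ∀ x ∈ e, x ∈ U

lemma card_KU {n : ℕ} (U : Finset (Fin n)) : (KU U).card ≤ U.card * U.card := by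
  rw [← Finset.card_product]
  refine le_trans (Finset.card_le_card ?_) (Finset.card_image_le (f := fun z => s(z.1, z.2)))
  intro e he
  induction e using Sym2.ind with
  | _ a b =>
  simp only [KU, Finset.mem_filter, Sym2.mem_iff] at he
  exact Finset.mem_image.mpr ⟨(a, b), by simp [he.2 a (by simp), he.2 b (by simp)], rfl⟩

/-- `v`-sets with `m` edges inside. -/
def Dns (n v m : ℕ) : Finset (Finset (Fin n) × Finset (Sym2 (Fin n))) :=
  (Finset.powersetCard v Finset.univ).biUnion fun U =>
    (Finset.powersetCard m (KU U)).image fun E => (U, E)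

lemma mem_Dns {n v m : ℕ} {U : Finset (Fin n)} {E : Finset (Sym2 (Fin n))} :
    (U, E) ∈ Dns n v m ↔ U.card = v ∧ E ⊆ KU U ∧ E.card = m := by
  simp only [Dns, Finset.mem_biUnion, Finset.mem_powersetCard, Finset.mem_image, Prod.mk.injEq]
  constructor
  · rintro ⟨U', ⟨-, h⟩, E', h', rfl, rfl⟩
    exact ⟨h, h'⟩
  · rintro ⟨h, h'⟩
    exact ⟨U, ⟨Finset.subset_univ _, h⟩, E, h', rfl, rfl⟩

lemma card_Dns (n v m : ℕ) : (Dns n v m).card ≤ n ^ v * 2 ^ (v * v) := by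
  unfold Dns
  refine (Finset.card_biUnion_le_card_mul _ _ (2 ^ (v * v)) ?_).trans ?_
  · intro U hU
    rw [Finset.mem_powersetCard] at hU
    refine Finset.card_image_le.trans ?_
    have h1 : (Finset.powersetCard m (KU U)).card ≤ (KU U).powerset.card :=
      Finset.card_le_card (by
        intro E hE
        exact Finset.mem_powerset.mpr (Finset.mem_powersetCard.mp hE).1)
    rw [Finset.card_powerset] at h1
    refine h1.trans (Nat.pow_le_pow_right (by norm_num) ?_)
    have := card_KU U
    rwa [hU.2] at this
  · refine Nat.mul_le_mul_right _ ?_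
    rw [Finset.card_powersetCard, Finset.card_univ, Fintype.card_fin]
    exact Nat.choose_le_pow _ _

lemma Ex_Dns {n : ℕ} {p : ℝ} (h0 : 0 ≤ p) (v m : ℕ) :
    Ex n p (cnt (Dns n v m) Prod.snd) ≤ (n : ℝ) ^ v * 2 ^ (v * v) * p ^ m := by
  rw [Ex_cnt]
  · have : ∀ i ∈ Dns n v m, p ^ i.2.card = p ^ m := by
      rintro ⟨U, E⟩ h
      rw [(mem_Dns.mp h).2.2]
    rw [Finset.sum_congr rfl this, Finset.sum_const, nsmul_eq_mul]
    refine mul_le_mul_of_nonneg_right ?_ (by positivity)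
    exact_mod_cast card_Dns n v m
  · rintro ⟨U, E⟩ h
    exact (mem_Dns.mp h).2.1.trans (Finset.filter_subset _ _)

lemma in_KU {n : ℕ} {G : SimpleGraph (Fin n)} {U : Finset (Fin n)} {E : Finset (Sym2 (Fin n))}
    (hE : ∀ e ∈ E, e ∈ G.edgeSet ∧ ∀ x ∈ e, x ∈ U) : E ⊆ KU U := by
  intro e he
  simp only [KU, Om, Finset.mem_filter, Finset.mem_univ, true_and]
  exact ⟨SimpleGraph.not_isDiag_of_mem_edgeSet G (hE e he).1, (hE e he).2⟩

/-- the exponent -/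
def mq (q v : ℕ) : ℕ := (3 * q * v - v) / q + 1

lemma not_sparse_cnt {n q N : ℕ} (hq : 1 ≤ q) {G : SimpleGraph (Fin n)} (h : ¬ Sparse G q N) :
    1 ≤ ∑ v ∈ Finset.Icc 1 N, cnt (Dns n v (mq q v)) Prod.snd G := by
  classical
  unfold Sparse at h
  push Not at h
  obtain ⟨U, E, hE, h1, h2, h3⟩ := h
  have hm : mq q U.card ≤ E.card := by
    unfold mq
    rw [Nat.succ_le_iff, Nat.div_lt_iff_lt_mul (by omega)]
    have : U.card ≤ 3 * q * U.card := by nlinarith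
    rw [mul_comm E.card]
    omega
  obtain ⟨E', hE', hc⟩ := Finset.exists_subset_card_eq hm
  have hE2 : ∀ e ∈ E', e ∈ G.edgeSet ∧ ∀ x ∈ e, x ∈ U := fun e he => hE e (hE' he)
  have hmem : (U, E') ∈ Dns n U.card (mq q U.card) := mem_Dns.mpr ⟨rfl, in_KU hE2, hc⟩
  have hnn : ∀ v, 0 ≤ cnt (Dns n v (mq q v)) Prod.snd G := fun v =>
    Finset.sum_nonneg fun i _ => ind_nonneg _ _ _
  refine le_trans ?_ (Finset.single_le_sum (f := fun v => cnt (Dns n v (mq q v)) Prod.snd G)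
    (fun v _ => hnn v) (Finset.mem_Icc.mpr ⟨h1, h2⟩))
  refine le_trans ?_ (Finset.single_le_sum (f := fun i => ind i.2 ∅ G)
    (fun i _ => ind_nonneg _ _ _) hmem)
  unfold ind
  rw [if_pos ⟨fun e he => (hE2 e he).1, by simp⟩]

lemma prob_not_sparse {n q N : ℕ} {ε p : ℝ} (hn : 1 ≤ n) (hε : 0 < ε) (h0 : 0 ≤ p) (h1 : p ≤ 1)
    (hp : p ≤ (n : ℝ) ^ (-(1 : ℝ) / 3 - ε)) (hq : 1 ≤ q) (hqε : 1 / 3 + ε ≤ 2 * ε * q) :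
    gnpProb n p {G | ¬ Sparse G q N} ≤ N * 2 ^ (N * N) * (n : ℝ) ^ (-ε) := by
  have hn1 : (1 : ℝ) ≤ n := by exact_mod_cast hn
  have hn0 : (0 : ℝ) < n := by linarith
  refine (prob_mono h0 h1 (B := {G | 1 ≤ ∑ v ∈ Finset.Icc 1 N,
    cnt (Dns n v (mq q v)) Prod.snd G}) fun G hG => not_sparse_cnt hq hG).trans ?_
  refine (markov h0 h1 (fun G => Finset.sum_nonneg fun v _ =>
    Finset.sum_nonneg fun i _ => ind_nonneg _ _ _) (le_refl _) one_pos).trans ?_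
  rw [div_one, Ex_sum]
  have : ∀ v ∈ Finset.Icc 1 N, Ex n p (cnt (Dns n v (mq q v)) Prod.snd) ≤
      2 ^ (N * N) * (n : ℝ) ^ (-ε) := by
    intro v hv
    rw [Finset.mem_Icc] at hv
    refine (Ex_Dns h0 v _).trans ?_
    have e1 : (2 : ℝ) ^ (v * v) ≤ 2 ^ (N * N) :=
      pow_le_pow_right₀ (by norm_num) (Nat.mul_le_mul hv.2 hv.2)
    have e2 : (n : ℝ) ^ v * p ^ (mq q v) ≤ (n : ℝ) ^ (-ε) := by
      have hpm : p ^ (mq q v) ≤ (n : ℝ) ^ ((-(1 : ℝ) / 3 - ε) * (mq q v : ℕ)) := by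
        rw [Real.rpow_mul hn0.le, Real.rpow_natCast]
        exact pow_le_pow_left₀ h0 hp _
      have hq0 : (0 : ℝ) < q := by exact_mod_cast hq
      have hmq : (3 * q - 1 : ℝ) * v ≤ q * (mq q v : ℕ) := by
        have : (3 * q * v - v) < q * mq q v := by
          unfold mq
          exact Nat.lt_mul_div_succ _ (by omega)
        have h2 : 3 * q * v ≤ q * mq q v + v := by omega
        have h3 : (3 * q * v : ℝ) ≤ q * (mq q v : ℕ) + v := by exact_mod_cast h2
        linarith
      have hv1 : (1 : ℝ) ≤ v := by exact_mod_cast hv.1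
      calc (n : ℝ) ^ v * p ^ (mq q v)
          ≤ (n : ℝ) ^ (v : ℝ) * (n : ℝ) ^ ((-(1 : ℝ) / 3 - ε) * (mq q v : ℕ)) := by
            rw [Real.rpow_natCast]
            exact mul_le_mul_of_nonneg_left hpm (by positivity)
        _ = (n : ℝ) ^ ((v : ℝ) + (-(1 : ℝ) / 3 - ε) * (mq q v : ℕ)) := by
            rw [Real.rpow_add hn0]
        _ ≤ (n : ℝ) ^ (-ε) := by
            apply Real.rpow_le_rpow_of_exponent_le hn1
            have key : (v : ℝ) * q + (-(1 : ℝ) / 3 - ε) * (q * (mq q v : ℕ)) ≤ -ε * q := by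
              have s1 : (1 / 3 + ε) * ((3 * q - 1 : ℝ) * v) ≤ (1 / 3 + ε) * (q * (mq q v : ℕ)) :=
                mul_le_mul_of_nonneg_left hmq (by positivity)
              have s2 : ε * q * 1 ≤ ε * q * v := mul_le_mul_of_nonneg_left hv1 (by positivity)
              have s3 : (1 / 3 + ε) * v ≤ 2 * ε * q * v :=
                mul_le_mul_of_nonneg_right hqε (by positivity)
              nlinarith
            have : ((v : ℝ) + (-(1 : ℝ) / 3 - ε) * (mq q v : ℕ)) * q ≤ -ε * q := by
              linarith
            exact le_of_mul_le_mul_right this hq0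
    calc (n : ℝ) ^ v * 2 ^ (v * v) * p ^ (mq q v)
        = 2 ^ (v * v) * ((n : ℝ) ^ v * p ^ (mq q v)) := by ring
      _ ≤ 2 ^ (N * N) * (n : ℝ) ^ (-ε) := by
        apply mul_le_mul e1 e2 (by positivity) (by positivity)
  refine (Finset.sum_le_sum this).trans ?_
  rw [Finset.sum_const, Nat.card_Icc, nsmul_eq_mul]
  simp [mul_assoc]

/-! ### Isolated vertices -/

/-- possible edges at `v` -/
def Dv {n : ℕ} (v : Fin n) : Finset (Sym2 (Fin n)) := (Om n).filter fun e => v ∈ e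

lemma Dv_eq {n : ℕ} (v : Fin n) : Dv v = (Finset.univ.erase v).image fun x => s(v, x) := by
  ext e
  simp only [Dv, Om, Finset.mem_filter, Finset.mem_univ, true_and, Finset.mem_image,
    Finset.mem_erase, and_true]
  constructor
  · rintro ⟨h1, h2⟩
    obtain ⟨y, rfl⟩ := h2
    exact ⟨y, fun h => h1 (by simp [h]), rfl⟩
  · rintro ⟨y, hy, rfl⟩
    exact ⟨by simpa using hy.symm, by simp⟩

lemma card_Dv {n : ℕ} (v : Fin n) : (Dv v).card = n - 1 := by
  rw [Dv_eq, Finset.card_image_of_injective, Finset.card_erase_of_mem (Finset.mem_univ _),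
    Finset.card_univ, Fintype.card_fin]
  intro a b h
  simp at h
  rcases h with h | ⟨h1, h2⟩
  · exact h
  · rw [h2, h1]

lemma card_Dv_union {n : ℕ} {u v : Fin n} (huv : u ≠ v) : 2 * n ≤ (Dv u ∪ Dv v).card + 3 := by
  have h1 := Finset.card_union_add_card_inter (Dv u) (Dv v)
  have h2 : (Dv u ∩ Dv v).card ≤ 1 := by
    rw [← Finset.card_singleton s(u, v)]
    apply Finset.card_le_card
    intro e he
    simp only [Dv, Finset.mem_inter, Finset.mem_filter] at he
    rw [Finset.mem_singleton]
    exact (Sym2.mem_and_mem_iff huv).mp ⟨he.1.2, he.2.2⟩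
  rw [card_Dv, card_Dv] at h1
  omega

lemma rangeI {n : ℕ} {p : ℝ} (hn : 6 ≤ n) (h0 : 0 ≤ p) (hnp : n * p ≤ 3) :
    gnpProb n p {G | ∃ T : SimpleGraph (Fin n), T.IsTree ∧ T ≤ G} ≤ (Real.exp 6 + 6) / n := by
  classical
  have hn6 : (6 : ℝ) ≤ n := by exact_mod_cast hn
  have hp2 : p ≤ 1 / 2 := by nlinarith
  set X : SimpleGraph (Fin n) → ℝ := fun G => ∑ v : Fin n, ind ∅ (Dv v) G with hX
  have hsub : ∀ v : Fin n, Dv v ⊆ Om n := fun v => Finset.filter_subset _ _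
  set r := 1 - p with hr
  have hr2 : 1 / 2 ≤ r := by rw [hr]; linarith
  have hr1 : r ≤ 1 := by rw [hr]; linarith
  have hr0 : 0 < r := by linarith
  have hEX : Ex n p X = n * r ^ (n - 1) := by
    rw [hX, Ex_sum]
    have : ∀ v ∈ (Finset.univ : Finset (Fin n)), Ex n p (ind ∅ (Dv v)) = r ^ (n - 1) := by
      intro v _
      rw [Ex_ind p _ _ (by simp) (hsub v) (by simp), card_Dv]
      simp [hr]
    rw [Finset.sum_congr rfl this]
    simp
  have hEXX : Ex n p (fun G => X G * X G) ≤ n * r ^ (n - 1) + n ^ 2 * r ^ (2 * n - 3) := by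
    simp only [hX, Finset.sum_mul_sum, ind_mul]
    rw [Ex_sum]
    have : ∀ u ∈ (Finset.univ : Finset (Fin n)),
        Ex n p (fun G => ∑ v : Fin n, ind (∅ ∪ ∅) (Dv u ∪ Dv v) G) ≤
          r ^ (n - 1) + n * r ^ (2 * n - 3) := by
      intro u _
      rw [Ex_sum]
      have hb : ∀ v ∈ (Finset.univ : Finset (Fin n)), Ex n p (ind (∅ ∪ ∅) (Dv u ∪ Dv v)) ≤
          (if v = u then r ^ (n - 1) else 0) + r ^ (2 * n - 3) := by
        intro v _
        rw [Ex_ind p _ _ (by simp) (Finset.union_subset (hsub u) (hsub v)) (by simp)]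
        simp only [Finset.empty_union, Finset.card_empty, pow_zero, one_mul, ← hr]
        split_ifs with h
        · subst h
          rw [Finset.union_self, card_Dv]
          have : 0 ≤ r ^ (2 * n - 3) := by positivity
          linarith
        · rw [zero_add]
          apply pow_le_pow_of_le_one hr0.le hr1
          have := card_Dv_union (Ne.symm h)
          omega
      refine (Finset.sum_le_sum hb).trans ?_
      rw [Finset.sum_add_distrib]
      simp
    refine (Finset.sum_le_sum this).trans ?_
    rw [Finset.sum_const, Finset.card_univ, Fintype.card_fin, nsmul_eq_mul]
    apply le_of_eq
    ring
  obtain ⟨k, rfl⟩ : ∃ k, n = k + 2 := ⟨n - 2, by omega⟩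
  have e1 : k + 2 - 1 = k + 1 := by omega
  have e2 : 2 * (k + 2) - 3 = k + (k + 1) := by omega
  rw [e1] at hEX hEXX
  rw [e2] at hEXX
  set N : ℝ := ((k + 2 : ℕ) : ℝ) with hN
  have hN0 : 0 < N := by linarith
  have hm0 : 0 < N * r ^ (k + 1) := by positivity
  have hch := chebyshev (v := N * r ^ (k + 1) + N ^ 2 * (p * r ^ (k + (k + 1)))) h0
    (by linarith) hEX (by
      refine hEXX.trans (le_of_eq ?_)
      have : p = 1 - r := by rw [hr]; ring
      rw [this]
      ring) hm0
  rw [sub_self] at hch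
  refine (prob_mono h0 (by linarith) ?_).trans (hch.trans ?_)
  · rintro G ⟨T, hT, hTG⟩
    change X G ≤ 0
    apply le_of_eq
    rw [hX]
    refine Finset.sum_eq_zero fun v _ => ?_
    unfold ind
    rw [if_neg]
    rintro ⟨-, h⟩
    have hpos := hT.1.preconnected.degree_pos_of_nontrivial v
    rw [SimpleGraph.degree_pos_iff_exists_adj] at hpos
    obtain ⟨y, hy⟩ := hpos
    exact h s(v, y) (by simp [Dv, Om, hy.ne]) (hTG hy)
  · -- numerical bound
    have hexp : Real.exp (-6) ≤ r ^ (k + 1) := by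
      have h3 : Real.exp (-(2 * p)) ≤ r := by
        have := Real.add_one_le_exp (2 * p)
        rw [Real.exp_neg]
        rw [inv_le_comm₀ (Real.exp_pos _) hr0]
        refine le_trans ?_ this
        rw [inv_le_iff_one_le_mul₀ hr0, hr]
        nlinarith
      calc Real.exp (-6) ≤ Real.exp (-(2 * p)) ^ (k + 2) := by
            rw [← Real.exp_nat_mul]
            apply Real.exp_le_exp.mpr
            nlinarith
        _ ≤ r ^ (k + 2) := pow_le_pow_left₀ (Real.exp_pos _).le h3 _
        _ ≤ r ^ (k + 1) := pow_le_pow_of_le_one hr0.le hr1 (by omega)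
    have hpr : p * N ≤ 3 := by linarith
    have h5 : (N * r ^ (k + 1) + N ^ 2 * (p * r ^ (k + (k + 1)))) / (N * r ^ (k + 1)) ^ 2
        = (1 / r ^ (k + 1) + (p * N) / r) / N := by
      field_simp
      ring
    rw [h5]
    apply div_le_div_of_nonneg_right _ hN0.le
    apply add_le_add
    · rw [one_div, inv_le_comm₀ (by positivity) (Real.exp_pos _), ← Real.exp_neg]
      exact hexp
    · rw [div_le_iff₀ hr0]
      nlinarith

/-! ### Counting edges and triangles -/

/-- the bad event -/
def Bad (n : ℕ) : Set (SimpleGraph (Fin n)) :=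
  {G | ∃ T : SimpleGraph (Fin n), T.IsTree ∧ T ≤ G ∧ Activates G T G}

open scoped Classical in
/-- ordered triangles -/
noncomputable def Trip (n : ℕ) : Finset (Fin n × Fin n × Fin n) :=
  Finset.univ.filter fun t => InG ⊤ t

lemma chose2 (n : ℕ) : ((n.choose 2 : ℕ) : ℝ) = n * (n - 1) / 2 := Nat.cast_choose_two ℝ n

lemma prob_edges {n : ℕ} {p : ℝ} (hn : 6 ≤ n) (h0 : 0 ≤ p) (h1 : p ≤ 1) (hnp : 3 ≤ n * p) :
    gnpProb n p {G | cnt (Om n) (fun e => {e}) G ≤ 11 / 24 * (n * (n - 1) * p)} ≤ 144 / n := by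
  classical
  have hn6 : (6 : ℝ) ≤ n := by exact_mod_cast hn
  have hsub : ∀ e ∈ Om n, ({e} : Finset (Sym2 (Fin n))) ⊆ Om n := by
    intro e he; simpa using he
  set m : ℝ := n * (n - 1) / 2 * p with hm
  have hEX : Ex n p (cnt (Om n) (fun e => {e})) = m := by
    rw [Ex_cnt p _ _ hsub]
    simp [card_Om, chose2, hm]
  have hEXX : Ex n p (fun G => cnt (Om n) (fun e => {e}) G * cnt (Om n) (fun e => {e}) G)
      ≤ m ^ 2 + m := by
    rw [Ex_cnt_sq p _ _ hsub]
    have : ∀ i ∈ Om n, ∑ j ∈ Om n, p ^ ({i} ∪ {j} : Finset (Sym2 (Fin n))).card ≤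
        p + (n * (n - 1) / 2) * p ^ 2 := by
      intro i hi
      have : ∀ j ∈ Om n, p ^ ({i} ∪ {j} : Finset (Sym2 (Fin n))).card ≤
          (if j = i then p else 0) + p ^ 2 := by
        intro j _
        split_ifs with h
        · subst h
          simp
          positivity
        · rw [← Finset.insert_eq, Finset.card_pair (Ne.symm h), zero_add]
      refine (Finset.sum_le_sum this).trans ?_
      rw [Finset.sum_add_distrib, Finset.sum_ite_eq' , if_pos hi]
      simp [card_Om, chose2]
    refine (Finset.sum_le_sum this).trans ?_
    rw [Finset.sum_const, nsmul_eq_mul, card_Om, chose2, hm]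
    apply le_of_eq
    ring
  have hmn : (n : ℝ) ≤ m := by rw [hm]; nlinarith
  have hch := chebyshev h0 h1 hEX hEXX (by linarith : 0 < m / 12)
  refine (prob_mono h0 h1 ?_).trans (hch.trans ?_)
  · intro G hG
    simp only [Set.mem_ofPred_eq] at hG ⊢
    rw [hm]
    linarith
  · have : m / (m / 12) ^ 2 = 144 / m := by field_simp; ring
    rw [this]
    apply div_le_div_of_nonneg_left (by norm_num) (by linarith) hmn

lemma prob_tri {n : ℕ} {p : ℝ} (hn : 6 ≤ n) (h0 : 0 ≤ p) (h1 : p ≤ 1) (hnp : 3 ≤ n * p) :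
    gnpProb n p {G | (n : ℝ) ^ 2 * p / 24 ≤ cnt (Trip n) tri G} ≤ 24 * (n * p ^ 2) := by
  classical
  have hn6 : (6 : ℝ) ≤ n := by exact_mod_cast hn
  have hp0 : 0 < p := by nlinarith
  have hE : Ex n p (cnt (Trip n) tri) ≤ (n : ℝ) ^ 3 * p ^ 3 := by
    rw [Ex_cnt]
    · have : ∀ t ∈ Trip n, p ^ (tri t).card = p ^ 3 := by
        intro t ht
        rw [tri_card (Finset.mem_filter.mp ht).2]
      rw [Finset.sum_congr rfl this, Finset.sum_const, nsmul_eq_mul]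
      refine mul_le_mul_of_nonneg_right ?_ (by positivity)
      have : (Trip n).card ≤ n ^ 3 := by
        refine (Finset.card_filter_le _ _).trans ?_
        simp
        apply le_of_eq; ring
      exact_mod_cast this
    · intro t ht e he
      have := tri_edge (Finset.mem_filter.mp ht).2 he
      simp only [Om, Finset.mem_filter, Finset.mem_univ, true_and]
      exact SimpleGraph.not_isDiag_of_mem_edgeSet _ this
  refine (markov h0 h1 (fun G => Finset.sum_nonneg fun i _ => ind_nonneg _ _ _) hE
    (by positivity)).trans (le_of_eq ?_)
  field_simp

lemma bad_edges {n : ℕ} {G : SimpleGraph (Fin n)} (hG : G ∈ Bad n) :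
    cnt (Om n) (fun e => {e}) G + 1 ≤ n + cnt (Trip n) tri G := by
  classical
  obtain ⟨T, hT, hTG, -, hA⟩ := hG
  obtain ⟨-, hE⟩ := edge_tri hTG hA
  rw [cnt_eq, cnt_eq]
  have hc := hT.card_edgeFinset
  rw [Fintype.card_fin] at hc
  have : ((Om n).filter fun e => ∀ e' ∈ ({e} : Finset (Sym2 (Fin n))), e' ∈ G.edgeSet).card ≤
      T.edgeFinset.card + ((Trip n).filter fun t => ∀ e ∈ tri t, e ∈ G.edgeSet).card := by
    refine le_trans (Finset.card_le_card (t := T.edgeFinset ∪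
      ((Trip n).filter fun t => ∀ e ∈ tri t, e ∈ G.edgeSet).image top) ?_) 
      ((Finset.card_union_le _ _).trans (Nat.add_le_add_left Finset.card_image_le _))
    intro e he
    simp only [Finset.mem_filter, Finset.mem_singleton, forall_eq] at he
    obtain ⟨-, he⟩ := he
    induction e using Sym2.ind with
    | _ a b =>
    rw [Finset.mem_union]
    rcases hE a b he with h | ⟨w, h1, h2, h3⟩
    · left
      simpa using h
    · right
      refine Finset.mem_image.mpr ⟨(a, b, w), ?_, rfl⟩
      have hin : InG G (a, b, w) := ⟨h1, h2, h3⟩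
      rw [Finset.mem_filter]
      refine ⟨?_, fun e he => tri_edge hin he⟩
      simp only [Trip, Finset.mem_filter, Finset.mem_univ, true_and]
      exact ⟨h1.ne, h2.ne, h3.ne⟩
  have h2 : ((Om n).filter fun e => ∀ e' ∈ ({e} : Finset (Sym2 (Fin n))), e' ∈ G.edgeSet).card + 1
      ≤ n + ((Trip n).filter fun t => ∀ e ∈ tri t, e ∈ G.edgeSet).card := by omega
  exact_mod_cast h2

lemma rangeII {n : ℕ} {p : ℝ} (hn : 6 ≤ n) (h0 : 0 ≤ p) (h1 : p ≤ 1) (hnp : 3 ≤ n * p) :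
    gnpProb n p (Bad n) ≤ 144 / n + 24 * (n * p ^ 2) := by
  have hn6 : (6 : ℝ) ≤ n := by exact_mod_cast hn
  refine le_trans (prob_mono h0 h1 ?_) ((prob_union h0 h1 _ _).trans
    (add_le_add (prob_edges hn h0 h1 hnp) (prob_tri hn h0 h1 hnp)))
  intro G hG
  have hb := bad_edges hG
  by_contra hcon
  simp only [Set.mem_union, Set.mem_ofPred_eq, not_or, not_le] at hcon
  obtain ⟨c1, c2⟩ := hcon
  nlinarith

/-! ### Counting four-cycles -/

lemma count_small_image {n : ℕ} (hn : 1 ≤ n) {ι : Type} [Fintype ι] [DecidableEq ι] (m : ℕ) :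
    ((Finset.univ : Finset (ι → Fin n)).filter fun F => (Finset.univ.image F).card ≤ m).card
      ≤ n ^ m * m ^ Fintype.card ι := by
  classical
  have hcard : (Finset.univ : Finset ((Fin m → Fin n) × (ι → Fin m))).card
      = n ^ m * m ^ Fintype.card ι := by simp
  rw [← hcard]
  refine le_trans (Finset.card_le_card ?_) (Finset.card_image_le (f := fun z => z.1 ∘ z.2))
  intro F hF
  simp only [Finset.mem_filter, Finset.mem_univ, true_and] at hF
  let e := (Finset.univ.image F).equivFin
  refine Finset.mem_image.mpr ⟨(fun i => if hi : i.1 < (Finset.univ.image F).card then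
    (e.symm ⟨i.1, hi⟩).1 else ⟨0, hn⟩, fun x => Fin.castLE hF (e ⟨F x, by simp⟩)),
    Finset.mem_univ _, ?_⟩
  funext x
  simp

/-- injective quadruples -/
def I4 (n : ℕ) : Finset (Fin 4 → Fin n) :=
  Finset.univ.filter fun f => (Finset.univ.image f).card = 4

/-- edges of a quadruple -/
def E4 {n : ℕ} (f : Fin 4 → Fin n) : Finset (Sym2 (Fin n)) :=
  {s(f 0, f 1), s(f 1, f 2), s(f 2, f 3), s(f 3, f 0)}

lemma I4_inj {n : ℕ} {f : Fin 4 → Fin n} (hf : f ∈ I4 n) : Function.Injective f := by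
  simp only [I4, Finset.mem_filter, Finset.mem_univ, true_and] at hf
  have h : Set.InjOn f ((Finset.univ : Finset (Fin 4)) : Set (Fin 4)) :=
    Finset.card_image_iff.mp (by rw [hf]; simp)
  intro a b hab
  exact h (by simp) (by simp) hab

lemma card_I4 {n : ℕ} (hn : 162 ≤ n) : (n : ℝ) ^ 4 / 2 ≤ (I4 n).card := by
  classical
  have h1 := count_small_image (n := n) (by omega) (ι := Fin 4) 3
  have h2 := Finset.card_filter_add_card_filter_not (s := (Finset.univ : Finset (Fin 4 → Fin n)))
    (fun F => (Finset.univ.image F).card ≤ 3)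
  have h3 : ((Finset.univ : Finset (Fin 4 → Fin n)).filter
      fun F => ¬ (Finset.univ.image F).card ≤ 3) = I4 n := by
    unfold I4
    apply Finset.filter_congr
    intro f _
    have : (Finset.univ.image f).card ≤ 4 := Finset.card_image_le.trans (by simp)
    omega
  rw [h3] at h2
  simp only [Finset.card_univ, Fintype.card_pi, Fintype.card_fin, Finset.prod_const] at h2 h1
  have h4 : n ^ 4 ≤ n ^ 3 * 3 ^ 4 + (I4 n).card := by omega
  have h5 : (n : ℝ) ^ 4 ≤ (n : ℝ) ^ 3 * 3 ^ 4 + (I4 n).card := by exact_mod_cast h4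
  have hn' : (162 : ℝ) ≤ n := by exact_mod_cast hn
  have h6 : 162 * (n : ℝ) ^ 3 ≤ n * (n : ℝ) ^ 3 := mul_le_mul_of_nonneg_right hn' (by positivity)
  nlinarith

lemma E4_Om {n : ℕ} {f : Fin 4 → Fin n} (hf : f ∈ I4 n) : E4 f ⊆ Om n := by
  have hi := I4_inj hf
  intro e he
  simp only [E4, Finset.mem_insert, Finset.mem_singleton] at he
  simp only [Om, Finset.mem_filter, Finset.mem_univ, true_and]
  rcases he with rfl | rfl | rfl | rfl <;> simp [hi.eq_iff]

lemma E4_card {n : ℕ} {f : Fin 4 → Fin n} (hf : f ∈ I4 n) : (E4 f).card = 4 := by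
  have hi := I4_inj hf
  unfold E4
  rw [Finset.card_insert_of_notMem, Finset.card_insert_of_notMem, Finset.card_insert_of_notMem,
    Finset.card_singleton] <;> simp [hi.eq_iff]

lemma E4_mem {n : ℕ} {f : Fin 4 → Fin n} {e : Sym2 (Fin n)} (he : e ∈ E4 f) {x : Fin n}
    (hx : x ∈ e) : x ∈ Finset.univ.image f := by
  simp only [E4, Finset.mem_insert, Finset.mem_singleton] at he
  rcases he with rfl | rfl | rfl | rfl <;> rcases Sym2.mem_iff.mp hx with rfl | rfl <;> simp

lemma E4_inter {n : ℕ} {f g : Fin 4 → Fin n} (hf : f ∈ I4 n) :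
    (E4 f ∩ E4 g).card ≤ (Finset.univ.image f ∩ Finset.univ.image g).card.choose 2 := by
  classical
  rw [← Sym2.card_image_offDiag]
  apply Finset.card_le_card
  intro e he
  rw [Finset.mem_inter] at he
  have h1 := E4_Om hf he.1
  induction e using Sym2.ind with
  | _ a b =>
  simp only [Om, Finset.mem_filter, Finset.mem_univ, true_and, Sym2.mk_isDiag_iff] at h1
  refine Finset.mem_image.mpr ⟨(a, b), ?_, rfl⟩
  rw [Finset.mem_offDiag, Finset.mem_inter, Finset.mem_inter]
  exact ⟨⟨E4_mem he.1 (by simp), E4_mem he.2 (by simp)⟩,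
    ⟨E4_mem he.1 (by simp), E4_mem he.2 (by simp)⟩, h1⟩

/-- size of joint image -/
def uim {n : ℕ} (z : (Fin 4 → Fin n) × (Fin 4 → Fin n)) : ℕ :=
  (Finset.univ.image (Sum.elim z.1 z.2)).card

lemma count_uim {n : ℕ} (hn : 1 ≤ n) (m : ℕ) :
    ((Finset.univ : Finset ((Fin 4 → Fin n) × (Fin 4 → Fin n))).filter
      fun z => uim z ≤ m).card ≤ n ^ m * m ^ 8 := by
  classical
  have := count_small_image (n := n) hn (ι := Fin 4 ⊕ Fin 4) m
  simp only [Fintype.card_sum, Fintype.card_fin] at this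
  refine le_trans ?_ this
  refine Finset.card_le_card_of_injOn (fun z => Sum.elim z.1 z.2) ?_ ?_
  · intro z hz
    have hz' := (Finset.mem_filter.mp hz).2
    exact Finset.mem_filter.mpr ⟨Finset.mem_univ _, hz'⟩
  · intro z _ z' _ h
    have h1 : z.1 = z'.1 := by
      funext i; exact congrFun h (Sum.inl i)
    have h2 : z.2 = z'.2 := by
      funext i; exact congrFun h (Sum.inr i)
    exact Prod.ext h1 h2

lemma pair_bound {n : ℕ} {p : ℝ} (h0 : 0 ≤ p) (h1 : p ≤ 1) {f g : Fin 4 → Fin n}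
    (hf : f ∈ I4 n) (hg : g ∈ I4 n) :
    p ^ (E4 f ∪ E4 g).card ≤ p ^ 8 + (if uim (f, g) ≤ 6 then p ^ 7 else 0) +
      (if uim (f, g) ≤ 5 then p ^ 4 else 0) := by
  have hu : uim (f, g) = (Finset.univ.image f ∪ Finset.univ.image g).card := by
    unfold uim
    congr 1
    ext x
    simp
  have hcf : (Finset.univ.image f).card = 4 := (Finset.mem_filter.mp hf).2
  have hcg : (Finset.univ.image g).card = 4 := (Finset.mem_filter.mp hg).2
  have a1 := Finset.card_union_add_card_inter (Finset.univ.image f) (Finset.univ.image g)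
  have a2 := Finset.card_union_add_card_inter (E4 f) (E4 g)
  have a3 := E4_inter (g := g) hf
  rw [E4_card hf, E4_card hg] at a2
  rw [hcf, hcg, ← hu] at a1
  have p8 : 0 ≤ p ^ 8 := by positivity
  have p7 : 0 ≤ p ^ 7 := by positivity
  have p4 : 0 ≤ p ^ 4 := by positivity
  set s := (Finset.univ.image f ∩ Finset.univ.image g).card with hs
  rcases le_or_gt s 1 with h | h
  · have : s.choose 2 = 0 := Nat.choose_eq_zero_of_lt (by omega)
    have : (E4 f ∪ E4 g).card = 8 := by omega
    rw [this]
    split_ifs <;> linarith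
  · rcases Nat.lt_or_ge s 3 with h' | h'
    · have h2 : s = 2 := by omega
      rw [h2, Nat.choose_self] at a3
      have : p ^ (E4 f ∪ E4 g).card ≤ p ^ 7 := pow_le_pow_of_le_one h0 h1 (by omega)
      rw [if_pos (by omega)]
      split_ifs <;> linarith
    · have : p ^ (E4 f ∪ E4 g).card ≤ p ^ 4 := by
        apply pow_le_pow_of_le_one h0 h1
        rw [← E4_card hf]
        exact Finset.card_le_card Finset.subset_union_left
      rw [if_pos (by omega), if_pos (by omega)]
      linarith

lemma Ex_C4 {n : ℕ} {p : ℝ} : Ex n p (cnt (I4 n) E4) = (I4 n).card * p ^ 4 := by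
  rw [Ex_cnt p _ _ (fun f hf => E4_Om hf), Finset.sum_congr rfl (fun f hf => by rw [E4_card hf]),
    Finset.sum_const, nsmul_eq_mul]

lemma Ex_C4_sq {n : ℕ} {p : ℝ} (hn : 1 ≤ n) (h0 : 0 ≤ p) (h1 : p ≤ 1) :
    Ex n p (fun G => cnt (I4 n) E4 G * cnt (I4 n) E4 G) ≤
      ((I4 n).card * p ^ 4) ^ 2 + (6 ^ 8 * ((n : ℝ) ^ 6 * p ^ 7) + 5 ^ 8 * ((n : ℝ) ^ 5 * p ^ 4)) := by
  classical
  rw [Ex_cnt_sq p _ _ (fun f hf => E4_Om hf), ← Finset.sum_product']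
  have hb : ∀ z ∈ I4 n ×ˢ I4 n, p ^ (E4 z.1 ∪ E4 z.2).card ≤
      p ^ 8 + (if uim z ≤ 6 then p ^ 7 else 0) + (if uim z ≤ 5 then p ^ 4 else 0) := by
    rintro ⟨f, g⟩ hz
    rw [Finset.mem_product] at hz
    exact pair_bound h0 h1 hz.1 hz.2
  have hc : ∀ m : ℕ, ∀ r : ℝ, 0 ≤ r → ∑ z ∈ I4 n ×ˢ I4 n, (if uim z ≤ m then r else 0) ≤
      (n : ℝ) ^ m * m ^ 8 * r := by
    intro m r hr
    rw [← Finset.sum_filter, Finset.sum_const, nsmul_eq_mul]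
    refine mul_le_mul_of_nonneg_right ?_ hr
    have : ((I4 n ×ˢ I4 n).filter fun z => uim z ≤ m).card ≤ n ^ m * m ^ 8 :=
      (Finset.card_le_card (Finset.filter_subset_filter _ (Finset.subset_univ _))).trans
        (count_uim hn m)
    exact_mod_cast this
  refine (Finset.sum_le_sum hb).trans ?_
  rw [Finset.sum_add_distrib, Finset.sum_add_distrib, Finset.sum_const, nsmul_eq_mul,
    Finset.card_product]
  have c6 := hc 6 (p ^ 7) (by positivity)
  have c5 := hc 5 (p ^ 4) (by positivity)
  push_cast at c5 c6 ⊢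
  nlinarith

lemma prob_C4 {n : ℕ} {p : ℝ} (hn : 162 ≤ n) (h0 : 0 < p) (h1 : p ≤ 1) :
    gnpProb n p {G | cnt (I4 n) E4 G ≤ (n : ℝ) ^ 4 * p ^ 4 / 4} ≤
      16 * 6 ^ 8 / (n ^ 2 * p) + 16 * 5 ^ 8 / (n ^ 3 * p ^ 4) := by
  have hn' : (162 : ℝ) ≤ n := by exact_mod_cast hn
  have hn0 : (0 : ℝ) < n := by linarith
  have hI := card_I4 hn
  have p4 : 0 < p ^ 4 := by positivity
  have hm : (n : ℝ) ^ 4 * p ^ 4 / 2 ≤ (I4 n).card * p ^ 4 := by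
    nlinarith
  have hpos : 0 < (n : ℝ) ^ 4 * p ^ 4 / 2 := by positivity
  have hch := chebyshev h0.le h1 Ex_C4 (Ex_C4_sq (n := n) (by omega) h0.le h1)
    (by linarith : 0 < (I4 n).card * p ^ 4 / 2)
  refine (prob_mono h0.le h1 ?_).trans (hch.trans ?_)
  · intro G hG
    simp only [Set.mem_ofPred_eq] at hG ⊢
    linarith
  · refine (div_le_div_of_nonneg_left (by positivity) (by positivity)
      (pow_le_pow_left₀ (by positivity) (by linarith :
        (n : ℝ) ^ 4 * p ^ 4 / 4 ≤ (I4 n).card * p ^ 4 / 2) 2)).trans (le_of_eq ?_)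
    field_simp
    ring

/-- number of small dense configurations -/
noncomputable def Yd (n K : ℕ) (G : SimpleGraph (Fin n)) : ℝ :=
  ∑ v ∈ Finset.Icc 4 K, cnt (Dns n v (3 * v - 7)) Prod.snd G

lemma prob_Yd {n K : ℕ} {p : ℝ} (hn : 1 ≤ n) (hK : 1 ≤ K) (h0 : 0 < p) (h1 : p ≤ 1)
    (hnp : n * p ^ 3 ≤ 1) :
    gnpProb n p {G | (n : ℝ) ^ 4 * p ^ 4 / (8 * K ^ 4) ≤ Yd n K G} ≤
      8 * K ^ 5 * 2 ^ (K * K) * p := by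
  have hn0 : (0 : ℝ) < n := by exact_mod_cast hn
  have hK0 : (0 : ℝ) < K := by exact_mod_cast hK
  have hE : Ex n p (Yd n K) ≤ K * (2 ^ (K * K) * ((n : ℝ) ^ 4 * p ^ 5)) := by
    unfold Yd
    rw [Ex_sum]
    have : ∀ v ∈ Finset.Icc 4 K, Ex n p (cnt (Dns n v (3 * v - 7)) Prod.snd) ≤
        2 ^ (K * K) * ((n : ℝ) ^ 4 * p ^ 5) := by
      intro v hv
      rw [Finset.mem_Icc] at hv
      refine (Ex_Dns h0.le v _).trans ?_
      have e1 : (2 : ℝ) ^ (v * v) ≤ 2 ^ (K * K) :=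
        pow_le_pow_right₀ (by norm_num) (Nat.mul_le_mul hv.2 hv.2)
      obtain ⟨t, rfl⟩ : ∃ t, v = 4 + t := ⟨v - 4, by omega⟩
      have e2 : 3 * (4 + t) - 7 = 5 + 3 * t := by omega
      rw [e2]
      calc (n : ℝ) ^ (4 + t) * 2 ^ ((4 + t) * (4 + t)) * p ^ (5 + 3 * t)
          = 2 ^ ((4 + t) * (4 + t)) * ((n : ℝ) ^ 4 * p ^ 5 * (n * p ^ 3) ^ t) := by
            rw [mul_pow, ← pow_mul, pow_add, pow_add]; ring
        _ ≤ 2 ^ (K * K) * ((n : ℝ) ^ 4 * p ^ 5 * 1) := by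
            apply mul_le_mul e1 _ (by positivity) (by positivity)
            apply mul_le_mul_of_nonneg_left _ (by positivity)
            exact pow_le_one₀ (by positivity) hnp
        _ = _ := by ring
    refine (Finset.sum_le_sum this).trans ?_
    rw [Finset.sum_const, nsmul_eq_mul]
    apply mul_le_mul_of_nonneg_right _ (by positivity)
    have : (Finset.Icc 4 K).card ≤ K := by rw [Nat.card_Icc]; omega
    exact_mod_cast this
  refine (markov h0.le h1 (fun G => Finset.sum_nonneg fun v _ =>
    Finset.sum_nonneg fun i _ => ind_nonneg _ _ _) hE (by positivity)).trans (le_of_eq ?_)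
  field_simp

lemma bad_C4 {n q : ℕ} (hq : 1 ≤ q) {G : SimpleGraph (Fin n)} (hG : G ∈ Bad n)
    (hsp : Sparse G q (3 * cK q)) :
    cnt (I4 n) E4 G ≤ (12 * (8 * q + 1) : ℕ) ^ 4 * Yd n (12 * (8 * q + 1)) G := by
  classical
  obtain ⟨T, hT, hTG, -, hA⟩ := hG
  set K := 12 * (8 * q + 1) with hK
  unfold Yd
  simp only [cnt_eq]
  let D : ℕ → Finset (Finset (Fin n) × Finset (Sym2 (Fin n))) := fun v =>
    (Dns n v (3 * v - 7)).filter fun i => ∀ e ∈ i.2, e ∈ G.edgeSet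
  have key : ((I4 n).filter fun i => ∀ e ∈ E4 i, e ∈ G.edgeSet).card ≤
      ∑ v ∈ Finset.Icc 4 K, (D v).card * K ^ 4 := by
    refine le_trans (Finset.card_le_card (t := (Finset.Icc 4 K).biUnion fun v =>
      (D v).biUnion fun i => Fintype.piFinset fun _ : Fin 4 => i.1) ?_) ?_
    · intro f hf
      rw [Finset.mem_filter] at hf
      obtain ⟨hf4, hfE⟩ := hf
      have hi := I4_inj hf4
      obtain ⟨U, E, ha, hb, hc, hd, hE, hUc, hUE⟩ := four_cycle hq hT.2 hTG hsp hA
        (a := f 0) (b := f 1) (c := f 2) (d := f 3)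
        (hfE s(f 0, f 1) (by simp [E4])) (hfE s(f 1, f 2) (by simp [E4]))
        (hfE s(f 2, f 3) (by simp [E4])) (hfE s(f 3, f 0) (by simp [E4]))
        (by simp [hi.eq_iff]) (by simp [hi.eq_iff])
      have hfU : ∀ i, f i ∈ U := by
        intro i; fin_cases i <;> assumption
      have hU4 : 4 ≤ U.card := by
        rw [← (Finset.mem_filter.mp hf4).2]
        apply Finset.card_le_card
        intro x hx
        obtain ⟨i, -, rfl⟩ := Finset.mem_image.mp hx
        exact hfU i
      obtain ⟨E', hE', hcE'⟩ := Finset.exists_subset_card_eq (s := E) (n := 3 * U.card - 7)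
        (by omega)
      have hE2 : ∀ e ∈ E', e ∈ G.edgeSet ∧ ∀ x ∈ e, x ∈ U := fun e he => hE e (hE' he)
      refine Finset.mem_biUnion.mpr ⟨U.card, Finset.mem_Icc.mpr ⟨hU4, hUc⟩, ?_⟩
      refine Finset.mem_biUnion.mpr ⟨(U, E'), ?_, ?_⟩
      · rw [Finset.mem_filter]
        exact ⟨mem_Dns.mpr ⟨rfl, in_KU hE2, hcE'⟩, fun e he => (hE2 e he).1⟩
      · rw [Fintype.mem_piFinset]; exact hfU
    · refine Finset.card_biUnion_le.trans (Finset.sum_le_sum fun v hv => ?_)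
      refine Finset.card_biUnion_le_card_mul _ _ _ ?_
      rintro ⟨U, E⟩ hUE
      rw [Finset.mem_filter] at hUE
      rw [Fintype.card_piFinset]
      simp only [Finset.prod_const, Finset.card_univ, Fintype.card_fin]
      apply Nat.pow_le_pow_left
      rw [(mem_Dns.mp hUE.1).1]
      exact (Finset.mem_Icc.mp hv).2
  rw [← Finset.sum_mul, mul_comm] at key
  have key2 : (((I4 n).filter fun i => ∀ e ∈ E4 i, e ∈ G.edgeSet).card : ℝ) ≤
      (K : ℝ) ^ 4 * ∑ v ∈ Finset.Icc 4 K, ((D v).card : ℝ) := by exact_mod_cast key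
  exact key2

lemma rangeIII {n q : ℕ} {p : ℝ} (hq : 1 ≤ q) (hn : 162 ≤ n) (h0 : 0 < p) (h1 : p ≤ 1)
    (hnp : n * p ^ 3 ≤ 1) :
    gnpProb n p (Bad n) ≤ gnpProb n p {G | ¬ Sparse G q (3 * cK q)} +
      ((16 * 6 ^ 8 / (n ^ 2 * p) + 16 * 5 ^ 8 / (n ^ 3 * p ^ 4)) +
      8 * ((12 * (8 * q + 1) : ℕ) : ℝ) ^ 5 * 2 ^ ((12 * (8 * q + 1)) * (12 * (8 * q + 1))) * p) := by
  have hn0 : (0 : ℝ) < n := by exact_mod_cast (by omega : 0 < n)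
  refine le_trans (prob_mono h0.le h1 ?_) ((prob_union h0.le h1 _ _).trans
    (add_le_add le_rfl ((prob_union h0.le h1 _ _).trans (add_le_add (prob_C4 hn h0 h1)
      (prob_Yd (K := 12 * (8 * q + 1)) (by omega) (by omega) h0 h1 hnp)))))
  intro G hG
  by_contra hcon
  simp only [Set.mem_union, Set.mem_ofPred_eq, not_or, not_le, not_not] at hcon
  obtain ⟨c1, c2, c3⟩ := hcon
  have hb := bad_C4 hq hG c1
  set K := 12 * (8 * q + 1) with hK
  have hK0 : (0 : ℝ) < K := by exact_mod_cast (by omega : 0 < K)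
  rw [lt_div_iff₀ (by positivity)] at c3
  have : 0 < (n : ℝ) ^ 4 * p ^ 4 := by positivity
  nlinarith

/-! ### Conclusion -/

/-- the final bound -/
noncomputable def fbound (ε : ℝ) (q : ℕ) (n : ℕ) : ℝ :=
  ((3 * cK q : ℕ) : ℝ) * 2 ^ ((3 * cK q) * (3 * cK q)) * (n : ℝ) ^ (-ε) +
  (Real.exp 6 + 6) * (n : ℝ) ^ (-(1 : ℝ)) + 144 * (n : ℝ) ^ (-(1 : ℝ)) +
  24 * (n : ℝ) ^ (-(0.2 : ℝ)) + 16 * 6 ^ 8 * (n : ℝ) ^ (-(1 : ℝ)) +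
  16 * 5 ^ 8 * (n : ℝ) ^ (-(0.6 : ℝ)) +
  8 * ((12 * (8 * q + 1) : ℕ) : ℝ) ^ 5 * 2 ^ ((12 * (8 * q + 1)) * (12 * (8 * q + 1))) *
    (n : ℝ) ^ (-(1 / 3 : ℝ))

lemma tend_neg {c : ℝ} (hc : 0 < c) (A : ℝ) :
    Filter.Tendsto (fun n : ℕ => A * (n : ℝ) ^ (-c)) Filter.atTop (nhds 0) := by
  have h := (tendsto_rpow_neg_atTop hc).comp tendsto_natCast_atTop_atTop
  simpa using h.const_mul A

lemma fbound_tendsto {ε : ℝ} (hε : 0 < ε) (q : ℕ) :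
    Filter.Tendsto (fbound ε q) Filter.atTop (nhds 0) := by
  unfold fbound
  have := ((((((tend_neg hε (((3 * cK q : ℕ) : ℝ) * 2 ^ ((3 * cK q) * (3 * cK q)))).add
    (tend_neg one_pos (Real.exp 6 + 6))).add (tend_neg one_pos 144)).add
    (tend_neg (by norm_num : (0 : ℝ) < 0.2) 24)).add (tend_neg one_pos (16 * 6 ^ 8))).add
    (tend_neg (by norm_num : (0 : ℝ) < 0.6) (16 * 5 ^ 8))).add
    (tend_neg (by norm_num : (0 : ℝ) < 1 / 3) (8 * ((12 * (8 * q + 1) : ℕ) : ℝ) ^ 5 *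
      2 ^ ((12 * (8 * q + 1)) * (12 * (8 * q + 1)))))
  simpa only [add_zero] using this

lemma bad_bound {ε : ℝ} (hε : 0 < ε) {q : ℕ} (hq : 1 ≤ q) (hqε : 1 / 3 + ε ≤ 2 * ε * q)
    {n : ℕ} (hn : 162 ≤ n) {p : ℝ} (h0 : 0 ≤ p) (hp : p ≤ (n : ℝ) ^ (-(1 : ℝ) / 3 - ε)) :
    gnpProb n p (Bad n) ≤ fbound ε q n := by
  have hn' : (162 : ℝ) ≤ n := by exact_mod_cast hn
  have hn0 : (0 : ℝ) < n := by linarith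
  have hn1 : (1 : ℝ) ≤ n := by linarith
  have hp3 : p ≤ (n : ℝ) ^ (-(1 / 3 : ℝ)) :=
    hp.trans (Real.rpow_le_rpow_of_exponent_le hn1 (by linarith))
  have h1 : p ≤ 1 := hp3.trans (Real.rpow_le_one_of_one_le_of_nonpos hn1 (by norm_num))
  have hnp3 : n * p ^ 3 ≤ 1 := by
    have : p ^ 3 ≤ (n : ℝ)⁻¹ := by
      calc p ^ 3 ≤ ((n : ℝ) ^ (-(1 / 3 : ℝ))) ^ 3 := pow_le_pow_left₀ h0 hp3 3
        _ = (n : ℝ)⁻¹ := by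
          rw [← Real.rpow_natCast, ← Real.rpow_mul hn0.le, ← Real.rpow_neg_one]
          norm_num
    calc n * p ^ 3 ≤ n * (n : ℝ)⁻¹ := mul_le_mul_of_nonneg_left this hn0.le
      _ = 1 := mul_inv_cancel₀ hn0.ne'
  have hA : 0 ≤ ((3 * cK q : ℕ) : ℝ) * 2 ^ ((3 * cK q) * (3 * cK q)) * (n : ℝ) ^ (-ε) := by
    positivity
  have hBx : 0 ≤ (Real.exp 6 + 6) * (n : ℝ) ^ (-(1 : ℝ)) := by positivity
  have hC : 0 ≤ 144 * (n : ℝ) ^ (-(1 : ℝ)) := by positivity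
  have hD : 0 ≤ 24 * (n : ℝ) ^ (-(0.2 : ℝ)) := by positivity
  have hE : 0 ≤ 16 * 6 ^ 8 * (n : ℝ) ^ (-(1 : ℝ)) := by positivity
  have hF : 0 ≤ 16 * 5 ^ 8 * (n : ℝ) ^ (-(0.6 : ℝ)) := by positivity
  have hH : 0 ≤ 8 * ((12 * (8 * q + 1) : ℕ) : ℝ) ^ 5 *
    2 ^ ((12 * (8 * q + 1)) * (12 * (8 * q + 1))) * (n : ℝ) ^ (-(1 / 3 : ℝ)) := by positivity
  rcases le_or_gt (n * p) 3 with hr | hr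
  · have h2 := (prob_mono h0 h1 (A := Bad n)
      (B := {G | ∃ T : SimpleGraph (Fin n), T.IsTree ∧ T ≤ G})
      (fun G ⟨T, hT, hTG, _⟩ => ⟨T, hT, hTG⟩)).trans (rangeI (by omega) h0 hr)
    rw [div_eq_mul_inv, ← Real.rpow_neg_one] at h2
    unfold fbound
    linarith
  · rcases le_or_gt p ((n : ℝ) ^ (-(0.6 : ℝ))) with hs | hs
    · have h2 := rangeII (by omega) h0 h1 hr.le
      have h3 : n * p ^ 2 ≤ (n : ℝ) ^ (-(0.2 : ℝ)) := by
        calc n * p ^ 2 ≤ n * ((n : ℝ) ^ (-(0.6 : ℝ))) ^ 2 :=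
              mul_le_mul_of_nonneg_left (pow_le_pow_left₀ h0 hs 2) hn0.le
          _ = (n : ℝ) ^ (1 : ℝ) * (n : ℝ) ^ (-(1.2 : ℝ)) := by
              rw [← Real.rpow_natCast, ← Real.rpow_mul hn0.le, Real.rpow_one]
              norm_num
          _ = (n : ℝ) ^ (-(0.2 : ℝ)) := by
              rw [← Real.rpow_add hn0]; norm_num
      rw [div_eq_mul_inv, ← Real.rpow_neg_one] at h2
      unfold fbound
      linarith
    · have hp0 : 0 < p := lt_trans (by positivity) hs
      have h2 := rangeIII hq hn hp0 h1 hnp3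
      have h3 := prob_not_sparse (N := 3 * cK q) (by omega) hε h0 h1 hp hq hqε
      have h4 : 16 * 6 ^ 8 / ((n : ℝ) ^ 2 * p) ≤ 16 * 6 ^ 8 * (n : ℝ) ^ (-(1 : ℝ)) := by
        rw [Real.rpow_neg_one, ← div_eq_mul_inv]
        apply div_le_div_of_nonneg_left (by norm_num) hn0
        nlinarith
      have h5 : 16 * 5 ^ 8 / ((n : ℝ) ^ 3 * p ^ 4) ≤ 16 * 5 ^ 8 * (n : ℝ) ^ (-(0.6 : ℝ)) := by
        rw [Real.rpow_neg hn0.le, ← div_eq_mul_inv]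
        apply div_le_div_of_nonneg_left (by norm_num) (by positivity)
        calc (n : ℝ) ^ (0.6 : ℝ) = (n : ℝ) ^ (3 : ℝ) * (n : ℝ) ^ (-(2.4 : ℝ)) := by
              rw [← Real.rpow_add hn0]; norm_num
          _ = (n : ℝ) ^ 3 * ((n : ℝ) ^ (-(0.6 : ℝ))) ^ 4 := by
              rw [← Real.rpow_natCast, ← Real.rpow_natCast, ← Real.rpow_mul hn0.le]
              norm_num
          _ ≤ (n : ℝ) ^ 3 * p ^ 4 :=
              mul_le_mul_of_nonneg_left (pow_le_pow_left₀ (by positivity) hs.le 4) (by positivity)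
      have h6 : 8 * ((12 * (8 * q + 1) : ℕ) : ℝ) ^ 5 *
          2 ^ ((12 * (8 * q + 1)) * (12 * (8 * q + 1))) * p ≤
          8 * ((12 * (8 * q + 1) : ℕ) : ℝ) ^ 5 *
          2 ^ ((12 * (8 * q + 1)) * (12 * (8 * q + 1))) * (n : ℝ) ^ (-(1 / 3 : ℝ)) :=
        mul_le_mul_of_nonneg_left hp3 (by positivity)
      unfold fbound
      linarith

/-- If `p < n^{-1/3-ε}` then w.h.p. there is no tree `T ⊆ G` with
`T → G`, for `G ∼ G_{n,p}`. -/
theorem statement1 (ε : ℝ) (hε : 0 < ε) (p : ℕ → ℝ)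
    (hp0 : ∀ n : ℕ, 0 ≤ p n)
    (hp : ∀ n : ℕ, 1 ≤ n → p n < (n : ℝ) ^ (-(1 : ℝ) / 3 - ε)) :
    Filter.Tendsto
      (fun n => gnpProb n (p n)
        {G | ¬ ∃ T : SimpleGraph (Fin n), T.IsTree ∧ T ≤ G ∧ Activates G T G})
      Filter.atTop (nhds 1) := by
  obtain ⟨q0, hq0⟩ := exists_nat_ge ((1 / 3 + ε) / (2 * ε))
  have hq : 1 ≤ q0 + 1 := by omega
  have hqε : 1 / 3 + ε ≤ 2 * ε * ((q0 + 1 : ℕ) : ℝ) := by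
    rw [div_le_iff₀ (by positivity)] at hq0
    push_cast
    nlinarith
  have h1 : ∀ n, gnpProb n (p n)
      {G | ¬ ∃ T : SimpleGraph (Fin n), T.IsTree ∧ T ≤ G ∧ Activates G T G}
      = 1 - gnpProb n (p n) (Bad n) := fun n => prob_compl (Bad n)
  simp only [h1]
  have h2 : Filter.Tendsto (fun n => gnpProb n (p n) (Bad n)) Filter.atTop (nhds 0) := by
    refine tendsto_of_tendsto_of_tendsto_of_le_of_le' tendsto_const_nhds
      (fbound_tendsto hε (q0 + 1)) ?_ ?_
    · filter_upwards [Filter.eventually_ge_atTop 162] with n hn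
      have hn1 : (1 : ℝ) ≤ n := by exact_mod_cast (by omega : 1 ≤ n)
      exact prob_nonneg (hp0 n) ((hp n (by omega)).le.trans
        (Real.rpow_le_one_of_one_le_of_nonpos hn1 (by linarith))) _
    · filter_upwards [Filter.eventually_ge_atTop 162] with n hn
      exact bad_bound hε hq hqε hn (hp0 n) (hp n (by omega)).le
  simpa using h2.const_sub 1

end WSat
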